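/- arXiv:1102.5213 — 8 statements merged into one kernel-verified Lean document; each statement's English description precedes it below -/
import Mathlib

section
/- Let γ ∈ (1/2, 1], let ξ ∈ ℂ with Im ξ ≥ 0, and let r ∈ ℝ be such that ξ + r ≠ 0. Then for all 0 ≤ x ≤ x₁ one has |e^{-iξx} ∫_x^{x₁} e^{i(ξ+r)t}/(t+1)^γ dt| ≤ 2 / (|ξ + r| (x+1)^γ). -/
open MeasureTheory

/-- Integration-by-parts estimate for a single oscillatory exponential against `(t+1)^{-γ}`. -/
theorem oscillatory_integral_by_parts_estimate
    (γ : ℝ) (hγ : γ ∈ Set.Ioc (1 / 2 : ℝ) 1)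
    (ξ : ℂ) (hξ : 0 ≤ ξ.im) (r : ℝ) (hr : ξ + (r : ℂ) ≠ 0)
    (x x₁ : ℝ) (hx : 0 ≤ x) (hx₁ : x ≤ x₁) :
    ‖Complex.exp (-(Complex.I * ξ * (x : ℂ))) *
        ∫ t in x..x₁, Complex.exp (Complex.I * (ξ + (r : ℂ)) * (t : ℂ)) / (((t + 1) ^ γ : ℝ) : ℂ)‖
      ≤ 2 / (‖ξ + (r : ℂ)‖ * (x + 1) ^ γ) := by
  obtain ⟨w, hw⟩ : ∃ w : ℂ, w = ξ + r := ⟨_, rfl⟩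
  have hwim : w.im = ξ.im := by simp [hw]
  rw [← hw] at hr ⊢
  have hγ0 : 0 < γ := by linarith [hγ.1]
  have hpos : 0 < ‖w‖ := norm_pos_iff.mpr hr
  have hmem : ∀ t ∈ Set.uIcc x x₁, x ≤ t := fun t ht => by
    rw [Set.uIcc_of_le hx₁] at ht; exact ht.1
  have hIw : Complex.I * w ≠ 0 := mul_ne_zero Complex.I_ne_zero hr
  let c : ℂ := Complex.exp (-(Complex.I * ξ * (x : ℂ)))
  let g : ℝ → ℝ := fun t => (t + 1) ^ (-γ)
  let dg : ℝ → ℝ := fun t => (-γ) * (t + 1) ^ (-γ - 1)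
  let dv : ℝ → ℂ := fun t => c * Complex.exp (Complex.I * w * (t : ℂ))
  let v : ℝ → ℂ := fun t => dv t / (Complex.I * w)
  have hg : ∀ t ∈ Set.uIcc x x₁, HasDerivAt g (dg t) t := fun t ht => by
    have h1 : t + 1 ≠ 0 := by linarith [hmem t ht]
    have := ((hasDerivAt_id t).add_const 1).rpow_const (p := -γ) (Or.inl h1)
    simpa [g, dg] using this
  have hgc : ∀ t ∈ Set.uIcc x x₁, HasDerivAt (fun s => (g s : ℂ)) (dg t : ℂ) t :=
    fun t ht => (hg t ht).ofReal_comp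
  have hv : ∀ t ∈ Set.uIcc x x₁, HasDerivAt v (dv t) t := fun t _ => by
    have h1 : HasDerivAt (fun s : ℝ => Complex.I * w * (s : ℂ)) (Complex.I * w) t := by
      simpa using ((hasDerivAt_id t).ofReal_comp).const_mul (Complex.I * w)
    have h2 := (h1.cexp.const_mul c).div_const (Complex.I * w)
    refine HasDerivAt.congr_deriv h2 ?_
    change _ = c * Complex.exp (Complex.I * w * (t : ℂ))
    rw [← mul_assoc, mul_div_cancel_right₀ _ hIw]
  have hdgc : ContinuousOn dg (Set.uIcc x x₁) := by
    intro t ht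
    have h1 : t + 1 ≠ 0 := by linarith [hmem t ht]
    apply ContinuousAt.continuousWithinAt
    exact continuousAt_const.mul
      ((continuousAt_id.add continuousAt_const).rpow_const (Or.inl h1))
  have hdgi : IntervalIntegrable dg volume x x₁ := hdgc.intervalIntegrable
  have hdgci : IntervalIntegrable (fun t => (dg t : ℂ)) volume x x₁ :=
    (Complex.continuous_ofReal.comp_continuousOn hdgc).intervalIntegrable
  have hdvi : IntervalIntegrable dv volume x x₁ := by
    apply Continuous.intervalIntegrable
    fun_prop
  have ibp := intervalIntegral.integral_mul_deriv_eq_deriv_mul hgc hv hdgci hdvi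
  have hvn : ∀ t, x ≤ t → ‖v t‖ ≤ 1 / ‖w‖ := fun t ht => by
    have h1 : ‖dv t‖ ≤ 1 := by
      simp only [dv, c]
      rw [← Complex.exp_add, Complex.norm_exp, Real.exp_le_one_iff]
      simp [hwim]
      nlinarith
    have h2 : ‖Complex.I * w‖ = ‖w‖ := by rw [norm_mul, Complex.norm_I, one_mul]
    change ‖dv t / (Complex.I * w)‖ ≤ _
    rw [norm_div, h2]
    exact div_le_div_of_nonneg_right h1 hpos.le
  have hgn : ∀ t, x ≤ t → 0 ≤ g t := fun t ht => Real.rpow_nonneg (by linarith) _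
  have hb : ∀ t, x ≤ t → ‖(g t : ℂ) * v t‖ ≤ g t * (1 / ‖w‖) := fun t ht => by
    rw [norm_mul, Complex.norm_real, Real.norm_of_nonneg (hgn t ht)]
    exact mul_le_mul_of_nonneg_left (hvn t ht) (hgn t ht)
  have hI : ‖∫ t in x..x₁, (dg t : ℂ) * v t‖ ≤ ∫ t in x..x₁, (-(1 / ‖w‖)) * dg t := by
    apply intervalIntegral.norm_integral_le_of_norm_le hx₁
    · refine Filter.Eventually.of_forall fun t ht => ?_
      have h0 : dg t ≤ 0 := by
        have := Real.rpow_nonneg (show 0 ≤ t + 1 by linarith [ht.1]) (-γ - 1)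
        simp only [dg]
        nlinarith
      rw [norm_mul, Complex.norm_real, Real.norm_of_nonpos h0]
      nlinarith [hvn t ht.1.le]
    · exact hdgi.const_mul _
  rw [intervalIntegral.integral_const_mul,
    intervalIntegral.integral_eq_sub_of_hasDerivAt hg hdgi] at hI
  have key : c * (∫ t in x..x₁, Complex.exp (Complex.I * w * (t : ℂ)) / (((t + 1) ^ γ : ℝ) : ℂ))
      = ∫ t in x..x₁, (g t : ℂ) * dv t := by
    rw [← intervalIntegral.integral_const_mul]
    apply intervalIntegral.integral_congr
    intro t ht
    have h1 : 0 ≤ t + 1 := by linarith [hmem t ht]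
    simp only [g, dv, Real.rpow_neg h1, Complex.ofReal_inv]
    ring
  have hfin : 2 / (‖w‖ * (x + 1) ^ γ) = 2 * (g x * (1 / ‖w‖)) := by
    simp only [g]
    rw [Real.rpow_neg (by linarith)]
    field_simp
  change ‖c * _‖ ≤ _
  rw [key, ibp, hfin]
  have t1 := norm_sub_le ((g x₁ : ℂ) * v x₁ - (g x : ℂ) * v x) (∫ t in x..x₁, (dg t : ℂ) * v t)
  have t2 := norm_sub_le ((g x₁ : ℂ) * v x₁) ((g x : ℂ) * v x)
  have b1 := hb x₁ hx₁
  have b2 := hb x le_rfl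
  linarith
end

section
/- Let a > 0, let γ ∈ (1/2, 1], and let δ ∈ ℝ and ω ∈ ℝ with 2aω/π ∉ ℤ. Let g : ℝ → ℂ be periodic with period a and integrable on (0, a), whose Fourier coefficients g_n := (1/a)∫_0^a g(x) e^{-2πinx/a} dx satisfy Σ_{n∈ℤ} |g_n| < ∞. Then there exists a constant C ≥ 0 such that for all 0 ≤ x ≤ y one has |∫_x^y sin(2ωt+δ) g(t)/(t+1)^γ dt| ≤ C/(x+1)^γ; in particular the partial integrals ∫_x^y sin(2ωt+δ) g(t)/(t+1)^γ dt are uniformly bounded over all 0 ≤ x ≤ y. -/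
open MeasureTheory

/-- Abel-type estimate for real functions with bounded partial integrals. -/
lemma abel_real (γ : ℝ) (hγ : 0 < γ) (h : ℝ → ℝ)
    (hi : ∀ x y, IntervalIntegrable h volume x y) (M : ℝ)
    (hM : ∀ x y, |∫ t in x..y, h t| ≤ M) (x y : ℝ) (hx : 0 ≤ x) (hxy : x ≤ y) :
    |∫ t in x..y, (t + 1) ^ (-γ) * h t| ≤ M * (x + 1) ^ (-γ) := by
  have hpos : ∀ t ∈ Set.uIcc x y, 0 < t + 1 := by
    intro t ht
    rw [Set.uIcc_of_le hxy] at ht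
    linarith [ht.1]
  set w : ℝ → ℝ := fun t => (t + 1) ^ (-γ) with hw
  set F : ℝ → ℝ := fun s => ∫ t in x..s, h t with hF
  have hwd : ∀ t ∈ Set.uIcc x y, HasDerivAt w (-γ * (t + 1) ^ (-γ - 1)) t := by
    intro t ht
    have := ((hasDerivAt_id t).add_const 1).rpow_const (p := -γ) (Or.inl (hpos t ht).ne')
    simpa [hw] using this
  have hwac : AbsolutelyContinuousOnInterval w x y := by
    apply ContDiffOn.absolutelyContinuousOnInterval
    apply ContDiffOn.rpow_const_of_ne
    · fun_prop
    · intro t ht; exact (hpos t ht).ne'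
  have hFac : AbsolutelyContinuousOnInterval F x y :=
    (hi x y).absolutelyContinuousOnInterval_intervalIntegral (by simp)
  have hparts := hwac.integral_mul_deriv_eq_deriv_mul hFac
  have hL : ∫ t in x..y, w t * deriv F t = ∫ t in x..y, w t * h t := by
    apply intervalIntegral.integral_congr_ae
    filter_upwards [(hi x y).ae_hasDerivAt_integral] with t ht ht2
    rw [(ht (Set.uIoc_subset_uIcc ht2) x (by simp)).deriv]
  have hwdc : ContinuousOn (fun t : ℝ => -γ * (t + 1) ^ (-γ - 1)) (Set.uIcc x y) := by
    apply ContinuousOn.mul continuousOn_const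
    apply ContinuousOn.rpow_const
    · fun_prop
    · intro t ht; exact Or.inl (hpos t ht).ne'
  have hwdi : IntervalIntegrable (fun t : ℝ => -γ * (t + 1) ^ (-γ - 1)) volume x y :=
    hwdc.intervalIntegrable
  have hwint : ∫ t in x..y, -γ * (t + 1) ^ (-γ - 1) = w y - w x :=
    intervalIntegral.integral_eq_sub_of_hasDerivAt hwd hwdi
  have hR : |∫ t in x..y, deriv w t * F t| ≤ M * (w x - w y) := by
    have h1 : |∫ t in x..y, deriv w t * F t| ≤ ∫ t in x..y, (-M) * (-γ * (t + 1) ^ (-γ - 1)) := by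
      rw [← Real.norm_eq_abs]
      apply intervalIntegral.norm_integral_le_of_norm_le hxy
      · refine Filter.Eventually.of_forall fun t ht => ?_
        have htm : t ∈ Set.uIcc x y := by
          rw [Set.uIcc_of_le hxy]; exact Set.Ioc_subset_Icc_self ht
        rw [(hwd t htm).deriv, norm_mul, Real.norm_eq_abs, Real.norm_eq_abs]
        have hp : 0 < (t + 1) ^ (-γ - 1) := Real.rpow_pos_of_pos (hpos t htm) _
        rw [abs_of_nonpos (by nlinarith)]
        have := mul_le_mul_of_nonneg_left (hM x t) (mul_pos hγ hp).le
        simp only [hF]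
        nlinarith
      · exact hwdi.const_mul _
    rw [intervalIntegral.integral_const_mul, hwint] at h1
    linarith
  rw [hL] at hparts
  change |∫ t in x..y, w t * h t| ≤ M * w x
  have hFx : F x = 0 := by simp [hF]
  have hwy : 0 ≤ w y := Real.rpow_nonneg (hpos y (by simp)).le _
  rw [hparts, hFx]
  have h2 : |w y * F y| ≤ w y * M := by
    rw [abs_mul, abs_of_nonneg hwy]
    exact mul_le_mul_of_nonneg_left (hM x y) hwy
  rw [abs_le] at *
  constructor <;> nlinarith

/-- Abel-type estimate for complex functions with bounded partial integrals. -/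
lemma abel_complex (γ : ℝ) (hγ : 0 < γ) (h : ℝ → ℂ)
    (hi : ∀ x y, IntervalIntegrable h volume x y) (M : ℝ)
    (hM : ∀ x y, ‖∫ t in x..y, h t‖ ≤ M) (x y : ℝ) (hx : 0 ≤ x) (hxy : x ≤ y) :
    ‖∫ t in x..y, (((t + 1) ^ (-γ) : ℝ) : ℂ) * h t‖ ≤ 2 * M * (x + 1) ^ (-γ) := by
  have hire : ∀ x y, IntervalIntegrable (fun t => (h t).re) volume x y := fun x y =>
    ⟨(hi x y).1.re, (hi x y).2.re⟩
  have hiim : ∀ x y, IntervalIntegrable (fun t => (h t).im) volume x y := fun x y =>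
    ⟨(hi x y).1.im, (hi x y).2.im⟩
  have hre : ∀ x y, |∫ t in x..y, (h t).re| ≤ M := by
    intro x y
    have := Complex.reCLM.intervalIntegral_comp_comm (hi x y)
    simp only [Complex.reCLM_apply] at this
    rw [this]
    exact (Complex.abs_re_le_norm _).trans (hM x y)
  have him : ∀ x y, |∫ t in x..y, (h t).im| ≤ M := by
    intro x y
    have := Complex.imCLM.intervalIntegral_comp_comm (hi x y)
    simp only [Complex.imCLM_apply] at this
    rw [this]
    exact (Complex.abs_im_le_norm _).trans (hM x y)
  have hci : IntervalIntegrable (fun t => (((t + 1) ^ (-γ) : ℝ) : ℂ) * h t) volume x y := by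
    apply (hi x y).continuousOn_mul
    apply Complex.continuous_ofReal.comp_continuousOn
    apply ContinuousOn.rpow_const
    · fun_prop
    · intro t ht
      rw [Set.uIcc_of_le hxy] at ht
      left; linarith [ht.1]
  have h1 := Complex.reCLM.intervalIntegral_comp_comm hci
  have h2 := Complex.imCLM.intervalIntegral_comp_comm hci
  simp only [Complex.reCLM_apply, Complex.imCLM_apply, Complex.re_ofReal_mul,
    Complex.im_ofReal_mul] at h1 h2
  have h3 := abel_real γ hγ _ hire M hre x y hx hxy
  have h4 := abel_real γ hγ _ hiim M him x y hx hxy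
  rw [h1] at h3
  rw [h2] at h4
  refine (Complex.norm_le_abs_re_add_abs_im _).trans ?_
  linarith

/-- Non-resonant exponentials times a periodic function have bounded partial integrals. -/
lemma exp_bounded (a : ℝ) (ha : 0 < a) (s : ℝ) (hs : Complex.exp (s * a * Complex.I) ≠ 1)
    (g : ℝ → ℂ) (hg_per : Function.Periodic g a)
    (hg : ∀ x y, IntervalIntegrable g volume x y) :
    ∃ M : ℝ, ∀ x y : ℝ, ‖∫ t in x..y, Complex.exp (s * t * Complex.I) * g t‖ ≤ M := by
  set q := Complex.exp (s * a * Complex.I) with hq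
  set f : ℝ → ℂ := fun t => Complex.exp (s * t * Complex.I) * g t with hf
  have hfi : ∀ x y, IntervalIntegrable f volume x y := fun x y =>
    (hg x y).continuousOn_mul (by fun_prop)
  set E : ℝ → ℂ := fun x => ∫ t in (0:ℝ)..x, f t with hE
  have hfa : ∀ t, f (t + a) = q * f t := by
    intro t
    simp only [hf, hq, hg_per t, ← mul_assoc, ← Complex.exp_add]
    congr 2
    push_cast; ring
  have hrec : ∀ x, E (x + a) = E a + q * E x := by
    intro x
    have h1 : E (x + a) = E a + ∫ t in a..(x + a), f t :=
      (intervalIntegral.integral_add_adjacent_intervals (hfi _ _) (hfi _ _)).symm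
    have h2 : ∫ t in (0:ℝ)..x, f (t + a) = ∫ t in (0 + a)..(x + a), f t :=
      intervalIntegral.integral_comp_add_right f a
    rw [h1, ← intervalIntegral.integral_const_mul]
    simp only [hfa, zero_add] at h2
    rw [h2]
  have hEc : Continuous E := intervalIntegral.continuous_primitive hfi 0
  set K := E a / (1 - q) with hK
  have h1q : 1 - q ≠ 0 := sub_ne_zero.mpr (Ne.symm hs)
  have hqn : ‖q‖ = 1 := by
    rw [hq, ← Complex.ofReal_mul, Complex.norm_exp_ofReal_mul_I]
  have hper : Function.Periodic (fun x => ‖E x - K‖) a := by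
    intro x
    have : E (x + a) - K = q * (E x - K) := by
      rw [hrec, hK]; field_simp; ring
    simp only [this, norm_mul, hqn, one_mul]
  obtain ⟨B, hB⟩ := (hper.isBounded_of_continuous ha.ne' (by fun_prop)).exists_norm_le
  have hBn : ∀ x, ‖E x - K‖ ≤ B := fun x => by
    simpa using hB _ (Set.mem_range_self x)
  refine ⟨B + B, fun x y => ?_⟩
  have : ∫ t in x..y, f t = (E y - K) - (E x - K) := by
    rw [sub_sub_sub_cancel_right]
    exact (intervalIntegral.integral_interval_sub_left (hfi _ _) (hfi _ _)).symm
  rw [this]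
  exact (norm_sub_le _ _).trans (add_le_add (hBn y) (hBn x))

/-- Uniform boundedness of the partial integrals `∫_x^y sin(2ωt+δ) g(t)/(t+1)^γ dt`
for periodic `g` under the non-resonance condition `2aω/π ∉ ℤ`. -/
theorem uniform_bound_sin_periodic_partial_integrals
    (a : ℝ) (ha : 0 < a) (γ : ℝ) (hγ : γ ∈ Set.Ioc (1 / 2 : ℝ) 1)
    (δ ω : ℝ) (hω : ∀ n : ℤ, 2 * a * ω / Real.pi ≠ (n : ℝ))
    (g : ℝ → ℂ) (hg_per : Function.Periodic g a)
    (hg_int : IntervalIntegrable g volume 0 a)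
    (c : ℤ → ℂ)
    (hc : ∀ n : ℤ, c n = (1 / (a : ℂ)) * ∫ x in (0:ℝ)..a,
        g x * Complex.exp (-(2 * (Real.pi : ℂ) * Complex.I * (n : ℂ) * (x : ℂ) / (a : ℂ))))
    (hsum : Summable fun n : ℤ => ‖c n‖) :
    ∃ C : ℝ, 0 ≤ C ∧ ∀ x y : ℝ, 0 ≤ x → x ≤ y →
      ‖∫ t in x..y, (Real.sin (2 * ω * t + δ) : ℂ) * g t / (((t + 1) ^ γ : ℝ) : ℂ)‖ ≤
        C / (x + 1) ^ γ := by
  have hg : ∀ x y, IntervalIntegrable g volume x y :=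
    hg_per.intervalIntegrable₀ ha.ne' hg_int
  have hres : ∀ ε : ℝ, ε = 1 ∨ ε = -1 →
      Complex.exp (((2 * ω * ε : ℝ) : ℂ) * a * Complex.I) ≠ 1 := by
    intro ε hε h
    rw [Complex.exp_eq_one_iff] at h
    obtain ⟨n, hn⟩ := h
    have h2 : 2 * ω * ε * a = n * (2 * Real.pi) := by
      have := congrArg Complex.im hn
      simpa using this
    have hpi := Real.pi_ne_zero
    rcases hε with rfl | rfl
    · apply hω (2 * n)
      rw [div_eq_iff hpi]; push_cast; linarith
    · apply hω (-(2 * n))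
      rw [div_eq_iff hpi]; push_cast; linarith
  obtain ⟨M₁, h₁⟩ := exp_bounded a ha _ (hres 1 (Or.inl rfl)) g hg_per hg
  obtain ⟨M₂, h₂⟩ := exp_bounded a ha _ (hres (-1) (Or.inr rfl)) g hg_per hg
  set h : ℝ → ℂ := fun t => (Real.sin (2 * ω * t + δ) : ℂ) * g t with hh
  have hi : ∀ x y, IntervalIntegrable h volume x y := fun x y =>
    (hg x y).continuousOn_mul (by fun_prop)
  have hdec : ∀ t, h t =
      (-Complex.I / 2 * Complex.exp (δ * Complex.I)) *
        (Complex.exp (((2 * ω * 1 : ℝ) : ℂ) * t * Complex.I) * g t) +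
      (Complex.I / 2 * Complex.exp (-δ * Complex.I)) *
        (Complex.exp (((2 * ω * (-1) : ℝ) : ℂ) * t * Complex.I) * g t) := by
    intro t
    simp only [hh, Complex.ofReal_sin, Complex.sin]
    have e1 : Complex.exp (((2 * ω * t + δ : ℝ) : ℂ) * Complex.I) =
        Complex.exp (δ * Complex.I) * Complex.exp (((2 * ω * 1 : ℝ) : ℂ) * t * Complex.I) := by
      rw [← Complex.exp_add]; congr 1; push_cast; ring
    have e2 : Complex.exp (-((2 * ω * t + δ : ℝ) : ℂ) * Complex.I) =
        Complex.exp (-δ * Complex.I) *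
          Complex.exp (((2 * ω * (-1) : ℝ) : ℂ) * t * Complex.I) := by
      rw [← Complex.exp_add]; congr 1; push_cast; ring
    rw [e1, e2]; ring
  have hn1 : ‖-Complex.I / 2 * Complex.exp (δ * Complex.I)‖ ≤ 1 := by
    rw [norm_mul, Complex.norm_exp_ofReal_mul_I]; norm_num
  have hn2 : ‖Complex.I / 2 * Complex.exp (-δ * Complex.I)‖ ≤ 1 := by
    rw [norm_mul, ← Complex.ofReal_neg, Complex.norm_exp_ofReal_mul_I]; norm_num
  have hM : ∀ x y, ‖∫ t in x..y, h t‖ ≤ M₁ + M₂ := by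
    intro x y
    simp only [hdec]
    rw [intervalIntegral.integral_add, intervalIntegral.integral_const_mul,
      intervalIntegral.integral_const_mul]
    · refine (norm_add_le _ _).trans (add_le_add ?_ ?_)
      · rw [norm_mul]
        exact (mul_le_of_le_one_left (norm_nonneg _) hn1).trans (h₁ x y)
      · rw [norm_mul]
        exact (mul_le_of_le_one_left (norm_nonneg _) hn2).trans (h₂ x y)
    · exact ((hg x y).continuousOn_mul (by fun_prop)).const_mul _
    · exact ((hg x y).continuousOn_mul (by fun_prop)).const_mul _
  have hM0 : 0 ≤ M₁ + M₂ := (norm_nonneg _).trans (hM 0 0)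
  refine ⟨2 * (M₁ + M₂), by linarith, fun x y hx hxy => ?_⟩
  have key := abel_complex γ (by linarith [hγ.1]) h hi _ hM x y hx hxy
  rw [Real.rpow_neg (by linarith), ← div_eq_mul_inv] at key
  convert key using 2
  apply intervalIntegral.integral_congr
  intro t ht
  rw [Set.uIcc_of_le hxy] at ht
  simp only [hh]
  rw [Real.rpow_neg (by linarith [ht.1]), Complex.ofReal_inv, div_eq_mul_inv, mul_comm]
end

section
/- Let ε > 0, β > 0 and γ ∈ (1/2, 1). Then there exists a constant c₂ = c₂(ε, β, γ) > 0 such that for every ξ₁ ∈ ℂ and ξ₂ ∈ ℝ satisfying 0 ≤ Im ξ₁ ≤ 1, |ξ₁| ≥ ε, |ξ₂| ≥ ε, and |Re ξ₁ - ξ₂| ≤ β · Im ξ₁, and for every x ≥ 0, one has |e^{iξ₁x} ∫_0^x (e^{-iξ₁t} - e^{-iξ₂t})/(t+1)^γ dt| ≤ c₂ / (x+1)^γ. -/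
open MeasureTheory

lemma aux_hasDeriv (ξ : ℂ) (t : ℝ) :
    HasDerivAt (fun t : ℝ => Complex.exp (-(Complex.I * ξ * (t : ℂ))))
      (-(Complex.I * ξ) * Complex.exp (-(Complex.I * ξ * (t : ℂ)))) t := by
  have h1 : HasDerivAt (fun t : ℝ => (t : ℂ)) 1 t := Complex.ofRealCLM.hasDerivAt
  have h2 := ((h1.const_mul (Complex.I * ξ)).neg).cexp
  refine HasDerivAt.congr_deriv h2 ?_
  simp only [Pi.neg_apply]
  ring

lemma aux_norm (ξ : ℂ) (t : ℝ) :
    ‖Complex.exp (-(Complex.I * ξ * (t : ℂ)))‖ = Real.exp (ξ.im * t) := by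
  rw [Complex.norm_exp]
  congr 1
  simp

lemma aux_sub_one (ξ : ℂ) (hb : 0 ≤ ξ.im) (t : ℝ) (ht : 0 ≤ t) :
    ‖Complex.exp (-(Complex.I * ξ * (t : ℂ))) - 1‖ ≤ ‖ξ‖ * t * Real.exp (ξ.im * t) := by
  have := norm_image_sub_le_of_norm_deriv_le_segment' (a := 0) (b := t)
    (f := fun t : ℝ => Complex.exp (-(Complex.I * ξ * (t : ℂ))))
    (f' := fun t : ℝ => -(Complex.I * ξ) * Complex.exp (-(Complex.I * ξ * (t : ℂ))))
    (C := ‖ξ‖ * Real.exp (ξ.im * t))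
    (fun s _ => (aux_hasDeriv ξ s).hasDerivWithinAt)
    (fun s hs => by
      rw [norm_mul, aux_norm, norm_neg, norm_mul, Complex.norm_I, one_mul]
      have : ξ.im * s ≤ ξ.im * t := mul_le_mul_of_nonneg_left hs.2.le hb
      gcongr) t ⟨ht, le_rfl⟩
  simp only [Complex.ofReal_zero, mul_zero, neg_zero, Complex.exp_zero, sub_zero] at this
  linarith

/-- Primitive of the difference of exponentials. -/
noncomputable def auxG (ξ₁ : ℂ) (ξ₂ : ℝ) (t : ℝ) : ℂ :=
  Complex.I * ((Complex.exp (-(Complex.I * ξ₁ * (t : ℂ))) - 1) / ξ₁ -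
    (Complex.exp (-(Complex.I * (ξ₂ : ℂ) * (t : ℂ))) - 1) / (ξ₂ : ℂ))

lemma auxG_deriv (ξ₁ : ℂ) (ξ₂ : ℝ) (h1 : ξ₁ ≠ 0) (h2 : (ξ₂ : ℂ) ≠ 0) (t : ℝ) :
    HasDerivAt (auxG ξ₁ ξ₂) (Complex.exp (-(Complex.I * ξ₁ * (t : ℂ))) -
      Complex.exp (-(Complex.I * (ξ₂ : ℂ) * (t : ℂ)))) t := by
  have := ((((aux_hasDeriv ξ₁ t).sub_const 1).div_const ξ₁).sub
    (((aux_hasDeriv ξ₂ t).sub_const 1).div_const (ξ₂ : ℂ))).const_mul Complex.I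
  refine HasDerivAt.congr_deriv this ?_
  generalize Complex.exp (-(Complex.I * ξ₁ * (t : ℂ))) = A
  generalize Complex.exp (-(Complex.I * (ξ₂ : ℂ) * (t : ℂ))) = B
  field_simp
  linear_combination (-A + B) * Complex.I_sq

lemma auxG_le1 (ε : ℝ) (hε : 0 < ε) (ξ₁ : ℂ) (ξ₂ : ℝ) (hb : 0 ≤ ξ₁.im) (h1 : ε ≤ ‖ξ₁‖)
    (h2 : ε ≤ |ξ₂|) (t : ℝ) (ht : 0 ≤ t) :
    ‖auxG ξ₁ ξ₂ t‖ ≤ 4 / ε * Real.exp (ξ₁.im * t) := by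
  have he : 1 ≤ Real.exp (ξ₁.im * t) := Real.one_le_exp (mul_nonneg hb ht)
  have n2 : ‖(ξ₂ : ℂ)‖ = |ξ₂| := by simp
  have e1 := aux_norm ξ₁ t
  have e2 := aux_norm ξ₂ t
  simp only [Complex.ofReal_im, zero_mul, Real.exp_zero] at e2
  have a1 : ‖(Complex.exp (-(Complex.I * ξ₁ * (t : ℂ))) - 1) / ξ₁‖
      ≤ 2 * Real.exp (ξ₁.im * t) / ε := by
    rw [norm_div]
    have := norm_sub_le (Complex.exp (-(Complex.I * ξ₁ * (t : ℂ)))) 1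
    rw [e1, norm_one] at this
    gcongr
    linarith
  have a2 : ‖(Complex.exp (-(Complex.I * (ξ₂ : ℂ) * (t : ℂ))) - 1) / (ξ₂ : ℂ)‖
      ≤ 2 * Real.exp (ξ₁.im * t) / ε := by
    rw [norm_div, n2]
    have := norm_sub_le (Complex.exp (-(Complex.I * (ξ₂ : ℂ) * (t : ℂ)))) 1
    rw [e2, norm_one] at this
    gcongr
    linarith
  unfold auxG
  rw [norm_mul, Complex.norm_I, one_mul]
  refine (norm_sub_le _ _).trans ((add_le_add a1 a2).trans (le_of_eq ?_))
  ring

lemma auxG_le2 (ε β : ℝ) (hε : 0 < ε) (ξ₁ : ℂ) (ξ₂ : ℝ) (hb : 0 ≤ ξ₁.im)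
    (h1 : ε ≤ ‖ξ₁‖)
    (h2 : ε ≤ |ξ₂|) (h : |ξ₁.re - ξ₂| ≤ β * ξ₁.im) (t : ℝ) (ht : 0 ≤ t) :
    ‖auxG ξ₁ ξ₂ t‖ ≤ 2 * (β + 1) / ε * (ξ₁.im * t * Real.exp (ξ₁.im * t)) := by
  have he : 1 ≤ Real.exp (ξ₁.im * t) := Real.one_le_exp (mul_nonneg hb ht)
  have n2 : ‖(ξ₂ : ℂ)‖ = |ξ₂| := by simp
  have p1 : 0 < ‖ξ₁‖ := hε.trans_le h1
  have p2 : 0 < |ξ₂| := hε.trans_le h2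
  have z1 : ξ₁ ≠ 0 := norm_pos_iff.1 p1
  have z2 : (ξ₂ : ℂ) ≠ 0 := norm_pos_iff.1 (n2 ▸ p2)
  have e2 := aux_norm ξ₂ t
  simp only [Complex.ofReal_im, zero_mul, Real.exp_zero] at e2
  have hd : ‖ξ₁ - ξ₂‖ ≤ (β + 1) * ξ₁.im := by
    have := Complex.norm_le_abs_re_add_abs_im (ξ₁ - ξ₂)
    simp only [Complex.sub_re, Complex.ofReal_re, Complex.sub_im, Complex.ofReal_im,
      sub_zero, abs_of_nonneg hb] at this
    linarith
  have s1 := aux_sub_one (ξ₁ - ξ₂) (by simpa using hb) t ht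
  have s2 := aux_sub_one ξ₂ (by simp) t ht
  simp only [Complex.sub_im, Complex.ofReal_im, sub_zero] at s1
  simp only [Complex.ofReal_im, zero_mul, Real.exp_zero, mul_one, n2] at s2
  have key : auxG ξ₁ ξ₂ t = Complex.I * (
      Complex.exp (-(Complex.I * (ξ₂ : ℂ) * (t : ℂ))) *
        (Complex.exp (-(Complex.I * (ξ₁ - ξ₂) * (t : ℂ))) - 1) / ξ₁ -
      (Complex.exp (-(Complex.I * (ξ₂ : ℂ) * (t : ℂ))) - 1) * (ξ₁ - ξ₂) / (ξ₁ * ξ₂)) := by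
    have : Complex.exp (-(Complex.I * ξ₁ * (t : ℂ))) =
        Complex.exp (-(Complex.I * (ξ₂ : ℂ) * (t : ℂ))) *
        Complex.exp (-(Complex.I * (ξ₁ - ξ₂) * (t : ℂ))) := by
      rw [← Complex.exp_add]; congr 1; ring
    unfold auxG
    rw [this]
    field_simp
    ring
  have b0 : 0 ≤ (β + 1) * ξ₁.im := (norm_nonneg _).trans hd
  have a1 : ‖Complex.exp (-(Complex.I * (ξ₂ : ℂ) * (t : ℂ))) *
        (Complex.exp (-(Complex.I * (ξ₁ - ξ₂) * (t : ℂ))) - 1) / ξ₁‖ ≤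
      ((β + 1) * ξ₁.im * t * Real.exp (ξ₁.im * t)) / ε := by
    rw [norm_div, norm_mul, e2, one_mul]
    have : ‖ξ₁ - ξ₂‖ * t * Real.exp (ξ₁.im * t)
      ≤ (β + 1) * ξ₁.im * t * Real.exp (ξ₁.im * t) := by gcongr
    exact div_le_div₀ (by positivity) (s1.trans this) hε h1
  have a2 : ‖(Complex.exp (-(Complex.I * (ξ₂ : ℂ) * (t : ℂ))) - 1) * (ξ₁ - ξ₂) / (ξ₁ * ξ₂)‖ ≤
      ((β + 1) * ξ₁.im * t * Real.exp (ξ₁.im * t)) / ε := by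
    rw [norm_div, norm_mul, norm_mul, n2]
    calc _ ≤ (|ξ₂| * t) * ((β + 1) * ξ₁.im) / (‖ξ₁‖ * |ξ₂|) := by gcongr
      _ = ((β + 1) * ξ₁.im * t * 1) / ‖ξ₁‖ := by field_simp
      _ ≤ _ := by
        apply div_le_div₀ (by positivity) _ hε h1
        gcongr
  rw [key, norm_mul, Complex.norm_I, one_mul]
  refine (norm_sub_le _ _).trans ((add_le_add a1 a2).trans (le_of_eq ?_))
  ring

/-- Lemma "estimate of the beginning": uniform estimate of
`e^{iξ₁x} ∫_0^x (e^{-iξ₁t} - e^{-iξ₂t})/(t+1)^γ dt`. -/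
theorem estimate_of_the_beginning
    (ε β γ : ℝ) (hε : 0 < ε) (hβ : 0 < β) (hγ : γ ∈ Set.Ioo (1 / 2 : ℝ) 1) :
    ∃ c₂ : ℝ, 0 < c₂ ∧ ∀ (ξ₁ : ℂ) (ξ₂ : ℝ),
      0 ≤ ξ₁.im → ξ₁.im ≤ 1 → ε ≤ ‖ξ₁‖ → ε ≤ |ξ₂| →
      |ξ₁.re - ξ₂| ≤ β * ξ₁.im →
      ∀ x : ℝ, 0 ≤ x →
        ‖Complex.exp (Complex.I * ξ₁ * (x : ℂ)) *
            ∫ t in (0:ℝ)..x,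
              (Complex.exp (-(Complex.I * ξ₁ * (t : ℂ))) -
                Complex.exp (-(Complex.I * (ξ₂ : ℂ) * (t : ℂ)))) / (((t + 1) ^ γ : ℝ) : ℂ)‖
          ≤ c₂ / (x + 1) ^ γ := by
  obtain ⟨hγ0, hγ1⟩ := hγ
  have hγp : 0 < γ := by linarith
  have hγq : 0 < 1 - γ := by linarith
  set D : ℝ := 2 * (β + 1) / ε with hD
  have hDp : 0 < D := by positivity
  refine ⟨4 / ε + D * (1 / (1 - γ) + 1), by positivity, ?_⟩
  intro ξ₁ ξ₂ hb _ h1 h2 h x hx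
  have n2 : ‖(ξ₂ : ℂ)‖ = |ξ₂| := by simp
  have z1 : ξ₁ ≠ 0 := norm_pos_iff.1 (hε.trans_le h1)
  have z2 : (ξ₂ : ℂ) ≠ 0 := norm_pos_iff.1 (n2 ▸ (hε.trans_le h2))
  set b := ξ₁.im with hbdef
  have hx1 : 0 < x + 1 := by linarith
  have nE : ‖Complex.exp (Complex.I * ξ₁ * (x : ℂ))‖ = Real.exp (-(b * x)) := by
    rw [Complex.norm_exp]; congr 1; simp [hbdef]
  set E := Complex.exp (Complex.I * ξ₁ * (x : ℂ)) with hE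
  -- the integrand with weight as negative power
  have hW : ∀ t : ℝ, 0 ≤ t → HasDerivAt (fun t : ℝ => (((t + 1) ^ (-γ) : ℝ) : ℂ))
      (((-γ * (t + 1) ^ (-γ - 1) : ℝ)) : ℂ) t := by
    intro t ht
    have : HasDerivAt (fun t : ℝ => (t + 1) ^ (-γ)) (-γ * (t + 1) ^ (-γ - 1)) t := by
      have h0 : HasDerivAt (fun t : ℝ => t + 1) 1 t := (hasDerivAt_id t).add_const 1
      have := h0.rpow_const (p := -γ) (Or.inl (by positivity))
      convert this using 1
      ring
    exact this.ofReal_comp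
  have hint : (∫ t in (0:ℝ)..x,
              (Complex.exp (-(Complex.I * ξ₁ * (t : ℂ))) -
                Complex.exp (-(Complex.I * (ξ₂ : ℂ) * (t : ℂ)))) / (((t + 1) ^ γ : ℝ) : ℂ))
      = auxG ξ₁ ξ₂ x * (((x + 1) ^ (-γ) : ℝ) : ℂ) -
        ∫ t in (0:ℝ)..x, auxG ξ₁ ξ₂ t * (((-γ * (t + 1) ^ (-γ - 1) : ℝ)) : ℂ) := by
    have ibp := intervalIntegral.integral_mul_deriv_eq_deriv_mul (a := 0) (b := x)
      (u := auxG ξ₁ ξ₂) (v := fun t : ℝ => (((t + 1) ^ (-γ) : ℝ) : ℂ))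
      (u' := fun t : ℝ => Complex.exp (-(Complex.I * ξ₁ * (t : ℂ))) -
                Complex.exp (-(Complex.I * (ξ₂ : ℂ) * (t : ℂ))))
      (v' := fun t : ℝ => (((-γ * (t + 1) ^ (-γ - 1) : ℝ)) : ℂ))
      (fun t _ => auxG_deriv ξ₁ ξ₂ z1 z2 t)
      (fun t ht => hW t (by rw [Set.uIcc_of_le hx] at ht; exact ht.1))
      (by apply Continuous.intervalIntegrable; fun_prop)
      (by
        apply ContinuousOn.intervalIntegrable
        rw [Set.uIcc_of_le hx]
        apply Complex.continuous_ofReal.comp_continuousOn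
        apply ContinuousOn.mul continuousOn_const
        apply ContinuousOn.rpow_const (by fun_prop)
        intro t ht
        left
        have := ht.1
        positivity)
    have g0 : auxG ξ₁ ξ₂ 0 = 0 := by simp [auxG]
    rw [ibp, g0, zero_mul, sub_zero, sub_sub_cancel]
    apply intervalIntegral.integral_congr
    intro t ht
    rw [Set.uIcc_of_le hx] at ht
    have := ht.1
    simp only
    rw [Real.rpow_neg (by positivity), Complex.ofReal_inv, div_eq_mul_inv]
  -- main bound on the remaining integral
  have hB : ∀ t ∈ Set.Icc 0 x, HasDerivAt (fun t : ℝ => D / (x + 1) *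
      ((t + 1) ^ (1 - γ) / (1 - γ) + Real.exp (b * (t - x)) * (x + 1) ^ (1 - γ)))
      (D / (x + 1) * ((t + 1) ^ (-γ) + b * Real.exp (b * (t - x)) * (x + 1) ^ (1 - γ))) t := by
    intro t ht
    have ht0 := ht.1
    have h0 : HasDerivAt (fun t : ℝ => t + 1) 1 t := (hasDerivAt_id t).add_const 1
    have h3 := (h0.rpow_const (p := 1 - γ) (Or.inl (by positivity))).div_const (1 - γ)
    have h4 : HasDerivAt (fun t : ℝ => b * (t - x)) (b * 1) t :=
      ((hasDerivAt_id t).sub_const x).const_mul b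
    have h5 := (h3.add (h4.exp.mul_const ((x + 1) ^ (1 - γ)))).const_mul (D / (x + 1))
    refine HasDerivAt.congr_deriv h5 ?_
    have : (1 : ℝ) - γ - 1 = -γ := by ring
    rw [this]
    field_simp
  have hcont : ContinuousOn (fun t : ℝ =>
      (D / (x + 1) * ((t + 1) ^ (-γ) + b * Real.exp (b * (t - x)) * (x + 1) ^ (1 - γ))))
      (Set.uIcc 0 x) := by
    rw [Set.uIcc_of_le hx]
    apply ContinuousOn.mul continuousOn_const
    apply ContinuousOn.add
    · apply ContinuousOn.rpow_const (by fun_prop)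
      intro t ht
      left
      have := ht.1
      positivity
    · fun_prop
  have hBint := intervalIntegral.integral_eq_sub_of_hasDerivAt (a := 0) (b := x)
    (fun t ht => hB t (by rwa [Set.uIcc_of_le hx] at ht)) hcont.intervalIntegrable
  have hrest : ‖∫ t in (0:ℝ)..x, E * (auxG ξ₁ ξ₂ t * (((-γ * (t + 1) ^ (-γ - 1) : ℝ)) : ℂ))‖ ≤
      ∫ t in (0:ℝ)..x,
      (D / (x + 1) * ((t + 1) ^ (-γ) + b * Real.exp (b * (t - x)) * (x + 1) ^ (1 - γ))) := by
    apply intervalIntegral.norm_integral_le_of_norm_le hx _ hcont.intervalIntegrable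
    refine Filter.Eventually.of_forall fun t ht => ?_
    have ht0 : 0 ≤ t := ht.1.le
    have ht1 : 0 < t + 1 := by linarith
    have hs : 0 ≤ x - t := by linarith [ht.2]
    have hG := auxG_le2 ε β hε ξ₁ ξ₂ hb h1 h2 h t ht0
    rw [← hD, ← hbdef] at hG
    have hp : 0 < (t + 1) ^ (-γ) := by positivity
    have hpow : (t + 1) ^ (-γ - 1) = (t + 1) ^ (-γ) / (t + 1) := Real.rpow_sub_one ht1.ne' _
    have hpow2 : (t + 1) ^ (1 - γ) = (t + 1) ^ (-γ) * (t + 1) := by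
      rw [← Real.rpow_add_one ht1.ne']; congr 1; ring
    have hmono : (t + 1) ^ (1 - γ) ≤ (x + 1) ^ (1 - γ) := by
      apply Real.rpow_le_rpow ht1.le _ hγq.le
      linarith
    have nw : ‖(((-γ * (t + 1) ^ (-γ - 1) : ℝ)) : ℂ)‖ = γ * ((t + 1) ^ (-γ) / (t + 1)) := by
      rw [Complex.norm_real, Real.norm_eq_abs, hpow, neg_mul, abs_neg, abs_of_nonneg (by positivity)]
    have he : Real.exp (b * (t - x)) = Real.exp (-(b * x)) * Real.exp (b * t) := by
      rw [← Real.exp_add]; congr 1; ring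
    have hbe : b * (x - t) * Real.exp (b * (t - x)) ≤ 1 := by
      have e0 : b * (x - t) ≤ Real.exp (b * (x - t)) := by
        linarith [Real.add_one_le_exp (b * (x - t))]
      have : Real.exp (b * (x - t)) * Real.exp (b * (t - x)) = 1 := by
        rw [← Real.exp_add, ← Real.exp_zero]; congr 1; ring
      rw [← this]
      gcongr
    rw [norm_mul, norm_mul, nE, nw]
    set w := (t + 1) ^ (-γ) with hw
    set e := Real.exp (b * (t - x)) with hee
    have hep : 0 < e := Real.exp_pos _
    calc Real.exp (-(b * x)) * (‖auxG ξ₁ ξ₂ t‖ * (γ * (w / (t + 1))))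
        ≤ Real.exp (-(b * x)) * ((D * (b * t * Real.exp (b * t))) * (1 * (w / (t + 1)))) := by
          gcongr
      _ = D * (b * e * w) * (t / (t + 1)) := by rw [he]; field_simp
      _ ≤ D * (b * e * w) * 1 := by
          gcongr
          rw [div_le_one ht1]; linarith
      _ = D / (x + 1) * ((b * (x - t) * e) * w + b * e * (w * (t + 1))) := by
          field_simp; ring
      _ ≤ D / (x + 1) * (1 * w + b * e * (x + 1) ^ (1 - γ)) := by
          rw [← hpow2]
          gcongr
      _ = _ := by ring
  have hxp : (x + 1) ^ (1 - γ) = (x + 1) / (x + 1) ^ γ := by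
    rw [Real.rpow_sub hx1, Real.rpow_one]
  have hxg : 0 < (x + 1) ^ γ := by positivity
  rw [hBint] at hrest
  rw [intervalIntegral.integral_const_mul] at hrest
  have hfin : ‖E * ∫ t in (0:ℝ)..x, auxG ξ₁ ξ₂ t * (((-γ * (t + 1) ^ (-γ - 1) : ℝ)) : ℂ)‖ ≤
      D * (1 / (1 - γ) + 1) / (x + 1) ^ γ := by
    refine hrest.trans ?_
    have : 0 ≤ D / (x + 1) *
      (((0:ℝ) + 1) ^ (1 - γ) / (1 - γ) + Real.exp (b * (0 - x)) * (x + 1) ^ (1 - γ)) := by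
      positivity
    refine (sub_le_self _ this).trans (le_of_eq ?_)
    rw [sub_self, mul_zero, Real.exp_zero, hxp]
    field_simp
  have hfirst : ‖E * (auxG ξ₁ ξ₂ x * (((x + 1) ^ (-γ) : ℝ) : ℂ))‖ ≤ 4 / ε / (x + 1) ^ γ := by
    have hG := auxG_le1 ε hε ξ₁ ξ₂ hb h1 h2 x hx
    rw [← hbdef] at hG
    have hee : Real.exp (-(b * x)) * Real.exp (b * x) = 1 := by
      rw [← Real.exp_add]; simp
    rw [norm_mul, norm_mul, nE, Complex.norm_real, Real.norm_eq_abs, abs_of_nonneg (by positivity),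
      Real.rpow_neg hx1.le]
    calc _ ≤ Real.exp (-(b * x)) * ((4 / ε * Real.exp (b * x)) * ((x + 1) ^ γ)⁻¹) := by gcongr
      _ = (Real.exp (-(b * x)) * Real.exp (b * x)) * (4 / ε / (x + 1) ^ γ) := by
        rw [div_eq_mul_inv _ ((x + 1) ^ γ)]; ring
      _ = _ := by rw [hee, one_mul]
  rw [hint, mul_sub, add_div]
  exact (norm_sub_le _ _).trans (add_le_add hfirst hfin)
end

section
/- Let γ ∈ (1/2, 1) and β > 0, and set c₃(γ) := sup_{y≥0} y^γ e^{-y} and c₄(β) := sup { |e^z - 1|/|z| : z ∈ ℂ, 0 < |z| ≤ √(β²+1) }. Let ξ₁ ∈ ℂ with 0 < Im ξ₁ ≤ 1 and ξ₂ ∈ ℝ with |ξ₁ - ξ₂| ≤ √(β²+1) · Im ξ₁. Then for every x ≥ 0 one has e^{-Im ξ₁ · x} ∫_0^{1/Im ξ₁} |e^{-i(ξ₁-ξ₂)t} - 1| / (t+1)^{γ+1} dt ≤ 2^{1-γ} e · c₃(γ) · c₄(β) · √(β²+1) / ((1-γ)(x+1)^γ). -/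
open MeasureTheory

theorem c3_bdd_aux (γ : ℝ) (h0 : 0 ≤ γ) (h1 : γ ≤ 1) :
    BddAbove ((fun y : ℝ => y ^ γ * Real.exp (-y)) '' Set.Ici 0) := by
  refine ⟨1, ?_⟩
  rintro _ ⟨y, hy, rfl⟩
  have hy : (0:ℝ) ≤ y := hy
  have e1 : y ^ γ ≤ (1 + y) ^ γ := Real.rpow_le_rpow hy (by linarith) h0
  have e2 : (1 + y) ^ γ ≤ (1 + y) ^ (1:ℝ) :=
    Real.rpow_le_rpow_of_exponent_le (by linarith) h1
  rw [Real.rpow_one] at e2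
  have e3 := Real.add_one_le_exp y
  have : y ^ γ ≤ Real.exp y := by linarith
  calc y ^ γ * Real.exp (-y) ≤ Real.exp y * Real.exp (-y) := by gcongr
    _ = 1 := by rw [← Real.exp_add]; simp

theorem c4_bdd_aux (R : ℝ) :
    BddAbove ((fun z : ℂ => ‖Complex.exp z - 1‖ / ‖z‖) '' {z : ℂ | z ≠ 0 ∧ ‖z‖ ≤ R}) := by
  refine ⟨Real.exp R, ?_⟩
  rintro _ ⟨z, ⟨hz, hzR⟩, rfl⟩
  have hz' : 0 < ‖z‖ := norm_pos_iff.mpr hz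
  have h := Complex.norm_exp_sub_sum_le_norm_mul_exp z 1
  simp only [Finset.sum_range_one, pow_zero, Nat.factorial_zero, Nat.cast_one, div_one,
    pow_one] at h
  change ‖Complex.exp z - 1‖ / ‖z‖ ≤ _
  rw [div_le_iff₀ hz']
  have := Real.exp_le_exp.mpr hzR
  nlinarith

/-- Estimate of the first piece `∫_0^{1/Im ξ₁} |e^{-i(ξ₁-ξ₂)t} - 1|/(t+1)^{γ+1} dt`
in the proof of the "estimate of the beginning" lemma. -/
theorem first_piece_estimate
    (γ β : ℝ) (hγ : γ ∈ Set.Ioo (1 / 2 : ℝ) 1) (hβ : 0 < β)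
    (c₃ c₄ : ℝ)
    (hc₃ : c₃ = sSup ((fun y : ℝ => y ^ γ * Real.exp (-y)) '' Set.Ici 0))
    (hc₄ : c₄ = sSup ((fun z : ℂ => ‖Complex.exp z - 1‖ / ‖z‖) ''
        {z : ℂ | z ≠ 0 ∧ ‖z‖ ≤ Real.sqrt (β ^ 2 + 1)}))
    (ξ₁ : ℂ) (ξ₂ : ℝ) (him : 0 < ξ₁.im) (him1 : ξ₁.im ≤ 1)
    (hdist : ‖ξ₁ - (ξ₂ : ℂ)‖ ≤ Real.sqrt (β ^ 2 + 1) * ξ₁.im)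
    (x : ℝ) (hx : 0 ≤ x) :
    Real.exp (-(ξ₁.im * x)) *
        ∫ t in (0:ℝ)..(1 / ξ₁.im),
          ‖Complex.exp (-(Complex.I * (ξ₁ - (ξ₂ : ℂ)) * (t : ℂ))) - 1‖ / (t + 1) ^ (γ + 1)
      ≤ 2 ^ (1 - γ) * Real.exp 1 * c₃ * c₄ * Real.sqrt (β ^ 2 + 1) /
          ((1 - γ) * (x + 1) ^ γ) := by
  obtain ⟨hγ0, hγ1⟩ := hγ
  set a := ξ₁.im with ha
  set R := Real.sqrt (β ^ 2 + 1) with hR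
  have hRpos : 0 < R := Real.sqrt_pos.mpr (by positivity)
  have h3 : ∀ y : ℝ, 0 ≤ y → y ^ γ * Real.exp (-y) ≤ c₃ := by
    intro y hy
    rw [hc₃]
    exact le_csSup (c3_bdd_aux γ (by linarith) hγ1.le) ⟨y, hy, rfl⟩
  have h4 : ∀ z : ℂ, ‖z‖ ≤ R → ‖Complex.exp z - 1‖ ≤ c₄ * ‖z‖ := by
    intro z hz
    by_cases h : z = 0
    · simp [h]
    · rw [← div_le_iff₀ (norm_pos_iff.mpr h), hc₄]
      exact le_csSup (c4_bdd_aux R) ⟨z, ⟨h, hz⟩, rfl⟩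
  have h40 : 0 ≤ c₄ := by
    have := h4 (R : ℂ) (by simp [abs_of_pos hRpos])
    have h' := (norm_nonneg _).trans this
    rw [Complex.norm_real, Real.norm_of_nonneg hRpos.le] at h'
    exact nonneg_of_mul_nonneg_left h' hRpos
  have ha0 : 0 ≤ 1 / a := by positivity
  have hI : (∫ t in (0:ℝ)..(1 / a),
      ‖Complex.exp (-(Complex.I * (ξ₁ - (ξ₂ : ℂ)) * (t : ℂ))) - 1‖ / (t + 1) ^ (γ + 1))
      ≤ ∫ t in (0:ℝ)..(1 / a), c₄ * R * a * (t + 1) ^ (-γ) := by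
    apply intervalIntegral.integral_mono_on ha0
    · apply ContinuousOn.intervalIntegrable
      rw [Set.uIcc_of_le ha0]
      apply ContinuousOn.div
      · fun_prop
      · apply ContinuousOn.rpow_const (by fun_prop)
        intro t ht
        left
        linarith [ht.1]
      · intro t ht
        have : 0 < t + 1 := by linarith [ht.1]
        positivity
    · apply ContinuousOn.intervalIntegrable
      rw [Set.uIcc_of_le ha0]
      apply ContinuousOn.mul (by fun_prop)
      apply ContinuousOn.rpow_const (by fun_prop)
      intro t ht
      left
      linarith [ht.1]
    · intro t ht
      have ht0 : 0 ≤ t := ht.1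
      have ht1 : 0 < t + 1 := by linarith
      have hta : a * t ≤ 1 := by
        have := ht.2
        rw [le_div_iff₀ him] at this
        linarith
      have hn : ‖-(Complex.I * (ξ₁ - (ξ₂ : ℂ)) * (t : ℂ))‖ ≤ R * (a * t) := by
        rw [norm_neg, norm_mul, norm_mul, Complex.norm_I, one_mul, Complex.norm_real,
          Real.norm_of_nonneg ht0]
        nlinarith
      have hb := h4 _ (hn.trans (by nlinarith))
      rw [div_le_iff₀ (by positivity), mul_assoc (c₄ * R * a), ← Real.rpow_add ht1]
      have : -γ + (γ + 1) = 1 := by ring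
      rw [this, Real.rpow_one]
      calc _ ≤ _ := hb
        _ ≤ c₄ * (R * (a * t)) := by gcongr
        _ ≤ c₄ * (R * (a * (t + 1))) := by gcongr; linarith
        _ = _ := by ring
  have hJ : (∫ t in (0:ℝ)..(1 / a), c₄ * R * a * (t + 1) ^ (-γ))
      ≤ c₄ * R * (2 ^ (1 - γ) * a ^ γ / (1 - γ)) := by
    have hg : 0 < 1 - γ := by linarith
    rw [intervalIntegral.integral_const_mul,
      intervalIntegral.integral_comp_add_right (fun t : ℝ => t ^ (-γ)),
      integral_rpow (Or.inl (by linarith))]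
    have e : -γ + 1 = 1 - γ := by ring
    rw [e]
    have k : (1 / a + 1) ^ (1 - γ) ≤ 2 ^ (1 - γ) * (a ^ γ / a) := by
      have : (1 / a + 1) ≤ 2 * a⁻¹ := by
        have := (one_le_inv₀ him).mpr him1
        rw [one_div]; linarith
      calc _ ≤ (2 * a⁻¹) ^ (1 - γ) := Real.rpow_le_rpow (by positivity) this hg.le
        _ = _ := by
          rw [Real.mul_rpow (by norm_num) (by positivity), Real.inv_rpow him.le,
            ← Real.rpow_neg him.le, neg_sub, Real.rpow_sub him, Real.rpow_one]
    have p : (0:ℝ) ≤ (0 + 1) ^ (1 - γ) := by positivity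
    calc c₄ * R * a * (((1 / a + 1) ^ (1 - γ) - (0 + 1) ^ (1 - γ)) / (1 - γ))
        ≤ c₄ * R * a * ((2 ^ (1 - γ) * (a ^ γ / a)) / (1 - γ)) := by
          gcongr; exact (sub_le_self _ p).trans k
      _ = _ := by field_simp
  have hg : 0 < 1 - γ := by linarith
  have hx1 : 0 < x + 1 := by linarith
  have hE : Real.exp (-(a * x)) * (a ^ γ * (x + 1) ^ γ) ≤ Real.exp 1 * c₃ := by
    have h := h3 (a * (x + 1)) (by positivity)
    rw [Real.mul_rpow him.le hx1.le] at h
    have e : Real.exp (-(a * x)) = Real.exp a * Real.exp (-(a * (x + 1))) := by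
      rw [← Real.exp_add]; congr 1; ring
    have q : 0 ≤ a ^ γ * (x + 1) ^ γ * Real.exp (-(a * (x + 1))) := by positivity
    calc _ = Real.exp a * (a ^ γ * (x + 1) ^ γ * Real.exp (-(a * (x + 1)))) := by
          rw [e]; ring
      _ ≤ Real.exp 1 * c₃ := by gcongr
  rw [le_div_iff₀ (by positivity)]
  calc _ ≤ Real.exp (-(a * x)) * (c₄ * R * (2 ^ (1 - γ) * a ^ γ / (1 - γ))) *
        ((1 - γ) * (x + 1) ^ γ) := by
        gcongr; exact hI.trans hJ
    _ = (Real.exp (-(a * x)) * (a ^ γ * (x + 1) ^ γ)) * (c₄ * R * 2 ^ (1 - γ)) := by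
        field_simp
    _ ≤ (Real.exp 1 * c₃) * (c₄ * R * 2 ^ (1 - γ)) := by gcongr
    _ = _ := by ring
end

section
/- Let γ ∈ (1/2, 1] and set c₃(γ) := sup_{y≥0} y^γ e^{-y}. Let ξ₁ ∈ ℂ with 0 < Im ξ₁ ≤ 1 and ξ₂ ∈ ℝ. Then for every x ≥ 2/Im ξ₁ one has e^{-Im ξ₁ · x} ∫_{1/Im ξ₁}^{x/2} |e^{-iξ₁t} - e^{-iξ₂t}| / (t+1)^{γ+1} dt ≤ 2^{γ+1} e · c₃(γ) / (γ (x+2)^γ). -/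
open MeasureTheory

/-- Estimate of the middle piece `∫_{1/Im ξ₁}^{x/2} |e^{-iξ₁t} - e^{-iξ₂t}|/(t+1)^{γ+1} dt`
in the proof of the "estimate of the beginning" lemma. -/
theorem middle_piece_estimate
    (γ : ℝ) (hγ : γ ∈ Set.Ioc (1 / 2 : ℝ) 1)
    (c₃ : ℝ) (hc₃ : c₃ = sSup ((fun y : ℝ => y ^ γ * Real.exp (-y)) '' Set.Ici 0))
    (ξ₁ : ℂ) (ξ₂ : ℝ) (him : 0 < ξ₁.im) (him1 : ξ₁.im ≤ 1)
    (x : ℝ) (hx : 2 / ξ₁.im ≤ x) :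
    Real.exp (-(ξ₁.im * x)) *
        ∫ t in (1 / ξ₁.im)..(x / 2),
          ‖Complex.exp (-(Complex.I * ξ₁ * (t : ℂ))) -
              Complex.exp (-(Complex.I * (ξ₂ : ℂ) * (t : ℂ)))‖ / (t + 1) ^ (γ + 1)
      ≤ 2 ^ (γ + 1) * Real.exp 1 * c₃ / (γ * (x + 2) ^ γ) := by
  obtain ⟨hγ0, hγ1⟩ := hγ
  have hγp : 0 < γ := by linarith
  set s := ξ₁.im with hs
  have hx2 : 1 / s ≤ x / 2 := by
    have : 2 / s = 2 * (1 / s) := by ring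
    linarith
  have hs1 : 0 < 1 / s := by positivity
  have hxpos : 0 < x := by linarith
  -- the pointwise bound from the supremum
  have hsup : ∀ y : ℝ, 0 ≤ y → y ^ γ * Real.exp (-y) ≤ c₃ := by
    intro y hy
    rw [hc₃]
    apply le_csSup
    · refine ⟨1, ?_⟩
      rintro _ ⟨z, hz, rfl⟩
      have hz0 : (0 : ℝ) ≤ z := hz
      have h1 : z ^ γ ≤ Real.exp z := by
        have h2 := Real.add_one_le_exp z
        rcases le_total z 1 with h | h
        · have := Real.rpow_le_one hz0 h hγp.le
          linarith
        · have := Real.rpow_le_rpow_of_exponent_le h hγ1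
          rw [Real.rpow_one] at this
          linarith
      have h3 : Real.exp z * Real.exp (-z) = 1 := by
        rw [← Real.exp_add]; simp
      have h4 := mul_le_mul_of_nonneg_right h1 (Real.exp_pos (-z)).le
      show z ^ γ * Real.exp (-z) ≤ 1
      linarith
    · exact ⟨y, hy, rfl⟩
  have hkey : s ^ γ * Real.exp (-(s * x / 2)) ≤ Real.exp 1 * c₃ * 2 ^ γ / (x + 2) ^ γ := by
    have h := hsup (s * ((x + 2) / 2)) (by positivity)
    rw [Real.mul_rpow him.le (by positivity), Real.div_rpow (by positivity) (by norm_num)] at h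
    have hA : 0 < (x + 2) ^ γ := by positivity
    have hB : (0 : ℝ) < 2 ^ γ := by positivity
    have hc : 0 ≤ c₃ := le_trans (by positivity) h
    rw [le_div_iff₀ hA]
    have he : Real.exp (-(s * x / 2)) = Real.exp (-(s * ((x + 2) / 2))) * Real.exp s := by
      rw [← Real.exp_add]; congr 1; ring
    have he1 : Real.exp s ≤ Real.exp 1 := Real.exp_le_exp.mpr him1
    calc s ^ γ * Real.exp (-(s * x / 2)) * (x + 2) ^ γ
        = (s ^ γ * ((x + 2) ^ γ / 2 ^ γ) * Real.exp (-(s * ((x + 2) / 2))))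
            * Real.exp s * 2 ^ γ := by
          rw [he]; field_simp
      _ ≤ c₃ * Real.exp 1 * 2 ^ γ := by gcongr
      _ = Real.exp 1 * c₃ * 2 ^ γ := by ring
  have hrint : ∫ t in (1 / s)..(x / 2), (t + 1) ^ (-(γ + 1)) ≤ s ^ γ / γ := by
    rw [intervalIntegral.integral_comp_add_right (fun t : ℝ => t ^ (-(γ + 1)))]
    rw [integral_rpow]
    · have e : -(γ + 1) + 1 = -γ := by ring
      rw [e, div_neg, ← neg_div, neg_sub]
      apply div_le_div_of_nonneg_right _ hγp.le
      have h1 : (0 : ℝ) ≤ (x / 2 + 1) ^ (-γ) := by positivity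
      have h2 : (1 / s + 1) ^ (-γ) ≤ (1 / s) ^ (-γ) :=
        Real.rpow_le_rpow_of_nonpos hs1 (by linarith) (by linarith)
      have h3 : (1 / s) ^ (-γ) = s ^ γ := by
        rw [one_div, Real.inv_rpow him.le, Real.rpow_neg him.le, inv_inv]
      linarith
    · right
      refine ⟨by intro h; linarith, ?_⟩
      rw [Set.uIcc_of_le (by linarith)]
      intro h
      linarith [h.1]
  have hcont : ContinuousOn (fun t : ℝ => (t + 1) ^ (-(γ + 1))) (Set.uIcc (1 / s) (x / 2)) := by
    rw [Set.uIcc_of_le hx2]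
    apply ContinuousOn.rpow_const (by fun_prop)
    intro t ht
    left
    have := ht.1
    intro h
    linarith
  have hmono : ∫ t in (1 / s)..(x / 2),
          ‖Complex.exp (-(Complex.I * ξ₁ * (t : ℂ))) -
              Complex.exp (-(Complex.I * (ξ₂ : ℂ) * (t : ℂ)))‖ / (t + 1) ^ (γ + 1)
      ≤ ∫ t in (1 / s)..(x / 2), 2 * Real.exp (s * x / 2) * (t + 1) ^ (-(γ + 1)) := by
    apply intervalIntegral.integral_mono_on hx2
    · apply ContinuousOn.intervalIntegrable
      rw [Set.uIcc_of_le hx2]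
      apply ContinuousOn.div
      · fun_prop
      · apply ContinuousOn.rpow_const (by fun_prop)
        intro t ht
        right
        linarith
      · intro t ht
        have : 0 < t + 1 := by linarith [ht.1]
        positivity
    · exact (continuousOn_const.mul hcont).intervalIntegrable
    · intro t ht
      have ht1 : 0 < t + 1 := by linarith [ht.1]
      rw [Real.rpow_neg ht1.le, ← div_eq_mul_inv]
      apply div_le_div_of_nonneg_right _ (by positivity)
      refine (norm_sub_le _ _).trans ?_
      rw [Complex.norm_exp, Complex.norm_exp]
      have r1 : (-(Complex.I * ξ₁ * (t : ℂ))).re = s * t := by simp [hs]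
      have r2 : (-(Complex.I * (ξ₂ : ℂ) * (t : ℂ))).re = 0 := by simp
      rw [r1, r2, Real.exp_zero]
      have h1 : Real.exp (s * t) ≤ Real.exp (s * x / 2) := by
        apply Real.exp_le_exp.mpr
        have := mul_le_mul_of_nonneg_left ht.2 him.le
        linarith
      have h2 : 1 ≤ Real.exp (s * x / 2) := Real.one_le_exp (by positivity)
      linarith
  rw [intervalIntegral.integral_const_mul] at hmono
  have hexp : Real.exp (-(s * x)) * Real.exp (s * x / 2) = Real.exp (-(s * x / 2)) := by
    rw [← Real.exp_add]; congr 1; ring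
  refine (mul_le_mul_of_nonneg_left (hmono.trans
    (mul_le_mul_of_nonneg_left hrint (by positivity))) (Real.exp_pos _).le).trans ?_
  calc Real.exp (-(s * x)) * (2 * Real.exp (s * x / 2) * (s ^ γ / γ))
      = 2 / γ * (s ^ γ * (Real.exp (-(s * x)) * Real.exp (s * x / 2))) := by ring
    _ = 2 / γ * (s ^ γ * Real.exp (-(s * x / 2))) := by rw [hexp]
    _ ≤ 2 / γ * (Real.exp 1 * c₃ * 2 ^ γ / (x + 2) ^ γ) := by gcongr
    _ = 2 ^ (γ + 1) * Real.exp 1 * c₃ / (γ * (x + 2) ^ γ) := by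
      rw [Real.rpow_add (by norm_num), Real.rpow_one]
      field_simp
end

section
/- Let λ : [0,∞) → ℂ and R : [0,∞) → M₂(ℂ) be continuous with ∫_0^∞ ‖R(t)‖ dt < ∞, and suppose there exists a constant M such that ∫_x^y Re λ(t) dt ≥ -M for all 0 ≤ x ≤ y. Then every differentiable solution u₁ : [0,∞) → ℂ² of the system u₁'(x) = (diag(λ(x), -λ(x)) + R(x)) u₁(x) satisfies, for every x ≥ 0, ‖u₁(x)‖ ≤ ‖u₁(0)‖ · e^{∫_0^x Re λ(t) dt} · √(1 + e^{4M}) · exp(√(1 + e^{4M}) ∫_0^∞ ‖R(t)‖ dt). -/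
open MeasureTheory Matrix


lemma gron (k φ : ℝ → ℝ) (hk : Continuous k) (hφ : Continuous φ) (hk0 : ∀ t, 0 ≤ k t) (A : ℝ)
    (h : ∀ x, 0 ≤ x → φ x ≤ A + ∫ t in (0:ℝ)..x, k t * φ t) (x : ℝ) (hx : 0 ≤ x) :
    φ x ≤ A * Real.exp (∫ t in (0:ℝ)..x, k t) := by
  set G : ℝ → ℝ := fun x => A + ∫ t in (0:ℝ)..x, k t * φ t with hG
  set K : ℝ → ℝ := fun x => ∫ t in (0:ℝ)..x, k t with hK
  have hGd : ∀ x, HasDerivAt G (k x * φ x) x := fun x =>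
    ((hk.mul hφ).integral_hasStrictDerivAt 0 x).hasDerivAt.const_add A
  have hKd : ∀ x, HasDerivAt K (k x) x := fun x => (hk.integral_hasStrictDerivAt 0 x).hasDerivAt
  have hd : ∀ x, HasDerivAt (fun x => G x * Real.exp (- K x))
      (k x * φ x * Real.exp (-K x) + G x * (Real.exp (- K x) * (- k x))) x := fun x =>
    (hGd x).mul (hKd x).neg.exp
  have hanti : AntitoneOn (fun x => G x * Real.exp (- K x)) (Set.Ici 0) := by
    apply antitoneOn_of_deriv_nonpos (convex_Ici 0)
    · exact fun x _ => (hd x).continuousAt.continuousWithinAt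
    · exact fun x _ => (hd x).differentiableAt.differentiableWithinAt
    · intro x hx
      rw [interior_Ici] at hx
      rw [(hd x).deriv]
      have h1 := h x (le_of_lt hx)
      have h2 : k x * φ x ≤ k x * G x := mul_le_mul_of_nonneg_left h1 (hk0 x)
      have h3 := mul_le_mul_of_nonneg_right h2 (Real.exp_pos (- K x)).le
      linarith
  have h0 := hanti (Set.mem_Ici.2 le_rfl) hx hx
  have e0 : G 0 * Real.exp (-K 0) = A := by simp [hG, hK]
  simp only [e0] at h0
  calc φ x ≤ G x := h x hx
    _ = (G x * Real.exp (-K x)) * Real.exp (K x) := by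
      rw [mul_assoc, ← Real.exp_add]; simp
    _ ≤ _ := mul_le_mul_of_nonneg_right h0 (Real.exp_pos _).le

/-- diagonal scaling bound -/
lemma diag_bound (α β : ℂ) (C : ℝ) (hC : 0 ≤ C) (hα : ‖α‖ ≤ C) (hβ : ‖β‖ ≤ C)
    (z : EuclideanSpace ℂ (Fin 2)) : ‖(!₂[α * z 0, β * z 1] : EuclideanSpace ℂ (Fin 2))‖ ≤ C * ‖z‖ := by
  rw [EuclideanSpace.norm_eq, EuclideanSpace.norm_eq]
  apply Real.sqrt_le_iff.2
  refine ⟨by positivity, ?_⟩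
  rw [mul_pow, Real.sq_sqrt (by positivity)]
  simp only [Fin.sum_univ_two, Matrix.cons_val_zero, Matrix.cons_val_one, norm_mul, mul_pow, mul_add]
  gcongr

lemma vec_deriv (α β : ℝ → ℂ) (a : ℂ) (u : ℝ → EuclideanSpace ℂ (Fin 2)) 
    (S : Matrix (Fin 2) (Fin 2) ℂ) (s : Set ℝ) (x : ℝ) 
    (hα : HasDerivAt α (- a * α x) x) (hβ : HasDerivAt β (a * β x) x)
    (hu : HasDerivWithinAt u ((Matrix.toEuclideanCLM (𝕜 := ℂ) (Matrix.diagonal ![a, -a] + S)) (u x)) s x) :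
    HasDerivWithinAt (fun t => (!₂[α t * u t 0, β t * u t 1] : EuclideanSpace ℂ (Fin 2)))
      !₂[α x * (Matrix.toEuclideanCLM (𝕜 := ℂ) S (u x)) 0, β x * (Matrix.toEuclideanCLM (𝕜 := ℂ) S (u x)) 1] s x := by
  have hi : ∀ i, HasDerivWithinAt (fun t => u t i) ((Matrix.toEuclideanCLM (𝕜 := ℂ) (Matrix.diagonal ![a, -a] + S)) (u x) i) s x := fun i =>
    ((EuclideanSpace.proj (𝕜 := ℂ) i).restrictScalars ℝ).hasFDerivAt.comp_hasDerivWithinAt x hu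
  have h0 := hα.hasDerivWithinAt.mul (hi 0)
  have h1 := hβ.hasDerivWithinAt.mul (hi 1)
  have key : HasDerivWithinAt (fun t => (![α t * u t 0, β t * u t 1] : Fin 2 → ℂ))
      ![α x * (Matrix.toEuclideanCLM (𝕜 := ℂ) S (u x)) 0, β x * (Matrix.toEuclideanCLM (𝕜 := ℂ) S (u x)) 1] s x := by
    rw [hasDerivWithinAt_pi]
    intro i
    fin_cases i
    · refine h0.congr_deriv ?_
      simp [map_add, Matrix.ofLp_toEuclideanCLM, Matrix.mulVec_diagonal]
      ring
    · refine h1.congr_deriv ?_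
      simp [map_add, Matrix.ofLp_toEuclideanCLM, Matrix.mulVec_diagonal]
      ring
  exact ((PiLp.continuousLinearEquiv 2 ℝ (fun _ : Fin 2 => ℂ)).symm.hasFDerivAt).comp_hasDerivWithinAt x key

/-- Levinson-type uniform estimate for solutions of the 2×2 system
`u₁' = (diag(λ, -λ) + R) u₁` on `[0, ∞)`. -/
theorem levinson_estimate
    (lam : ℝ → ℂ) (R : ℝ → Matrix (Fin 2) (Fin 2) ℂ)
    (hlam : ContinuousOn lam (Set.Ici 0)) (hR : ContinuousOn R (Set.Ici 0))
    (hRint : IntegrableOn (fun t => ‖Matrix.toEuclideanCLM (𝕜 := ℂ) (R t)‖) (Set.Ici 0))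
    (M : ℝ) (hM : ∀ x y : ℝ, 0 ≤ x → x ≤ y → -M ≤ ∫ t in x..y, (lam t).re)
    (u₁ : ℝ → EuclideanSpace ℂ (Fin 2))
    (hu : ∀ x ∈ Set.Ici (0 : ℝ), HasDerivWithinAt u₁
      ((Matrix.toEuclideanCLM (𝕜 := ℂ) (Matrix.diagonal ![lam x, -lam x] + R x)) (u₁ x))
      (Set.Ici 0) x)
    (x : ℝ) (hx : 0 ≤ x) :
    ‖u₁ x‖ ≤ ‖u₁ 0‖ * Real.exp (∫ t in (0:ℝ)..x, (lam t).re) *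
        Real.sqrt (1 + Real.exp (4 * M)) *
        Real.exp (Real.sqrt (1 + Real.exp (4 * M)) *
          ∫ t in Set.Ici (0:ℝ), ‖Matrix.toEuclideanCLM (𝕜 := ℂ) (R t)‖) := by
  have hmax : Continuous (fun t : ℝ => max t 0) := by fun_prop
  have hmaxm : ∀ t : ℝ, max t 0 ∈ Set.Ici (0:ℝ) := fun t => Set.mem_Ici.2 (le_max_right _ _)
  have hucont : ContinuousOn u₁ (Set.Ici 0) := fun y hy => (hu y hy).continuousWithinAt
  set a : ℝ → ℂ := fun t => lam (max t 0) with ha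
  have hac : Continuous a := hlam.comp_continuous hmax hmaxm
  have haeq : ∀ t, 0 ≤ t → a t = lam t := fun t ht => by simp [ha, ht]
  have hEc : Continuous (fun S : Matrix (Fin 2) (Fin 2) ℂ => Matrix.toEuclideanCLM (𝕜 := ℂ) S) :=
    LinearMap.continuous_of_finiteDimensional
      ((Matrix.toEuclideanCLM (n := Fin 2) (𝕜 := ℂ)).toAlgEquiv.toLinearMap)
  set k : ℝ → ℝ := fun t => ‖Matrix.toEuclideanCLM (𝕜 := ℂ) (R (max t 0))‖ with hk
  have hkc : Continuous k := (hEc.comp (hR.comp_continuous hmax hmaxm)).norm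
  have hkeq : ∀ t, 0 ≤ t → k t = ‖Matrix.toEuclideanCLM (𝕜 := ℂ) (R t)‖ :=
    fun t ht => by simp [hk, ht]
  have hk0 : ∀ t, 0 ≤ k t := fun t => norm_nonneg _
  set L : ℝ → ℂ := fun x => ∫ t in (0:ℝ)..x, a t with hL
  have hLd : ∀ x, HasDerivAt L (a x) x := fun x => (hac.integral_hasStrictDerivAt 0 x).hasDerivAt
  have hLc : Continuous L := continuous_iff_continuousAt.2 fun x => (hLd x).continuousAt
  have hL0 : L 0 = 0 := by simp [hL]
  have hLsub : ∀ s y, 0 ≤ s → s ≤ y → (L y).re - (L s).re = ∫ t in s..y, (lam t).re := by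
    intro s y hs hsy
    have h1 : L y - L s = ∫ t in s..y, a t :=
      intervalIntegral.integral_interval_sub_left (hac.intervalIntegrable _ _)
        (hac.intervalIntegrable _ _)
    have h2 : (∫ t in s..y, a t).re = ∫ t in s..y, (a t).re :=
      (Complex.reCLM.intervalIntegral_comp_comm (hac.intervalIntegrable s y)).symm
    rw [← Complex.sub_re, h1, h2]
    apply intervalIntegral.integral_congr
    intro t ht
    rw [Set.uIcc_of_le hsy] at ht
    simp only [haeq t (hs.trans ht.1)]
  have hM0 : 0 ≤ M := by have := hM 0 0 le_rfl le_rfl; simp at this; linarith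
  set C := Real.sqrt (1 + Real.exp (4 * M)) with hC
  have hC0 : 0 ≤ C := Real.sqrt_nonneg _
  have hCe : Real.exp (2 * M) ≤ C := by
    apply Real.le_sqrt_of_sq_le
    rw [← Real.exp_nat_mul]
    have : ((2:ℕ):ℝ) * (2 * M) = 4 * M := by push_cast; ring
    rw [this]; linarith
  have hC1 : 1 ≤ C := le_trans (Real.one_le_exp (by linarith)) hCe
  set φ : ℝ → ℝ := fun t => Real.exp (-(L t).re) * ‖u₁ (max t 0)‖ with hφ
  have hφc : Continuous φ := by
    have h1 := (hucont.comp_continuous hmax hmaxm).norm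
    have h2 : Continuous (fun t => Real.exp (-(L t).re)) :=
      Real.continuous_exp.comp (Complex.continuous_re.comp hLc).neg
    exact h2.mul h1
  have hint : ∀ y, 0 ≤ y → φ y ≤ C * ‖u₁ 0‖ + ∫ t in (0:ℝ)..y, (C * k t) * φ t := by
    intro y hy
    set α : ℝ → ℂ := fun s => Complex.exp (-L s) with hα
    set β : ℝ → ℂ := fun s => Complex.exp (L s - 2 * L y) with hβ
    have hαd : ∀ s, HasDerivAt α (-a s * α s) s := fun s => by
      have := (hLd s).neg.cexp
      exact this.congr_deriv (mul_comm _ _)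
    have hβd : ∀ s, HasDerivAt β (a s * β s) s := fun s => by
      have := ((hLd s).sub_const (2 * L y)).cexp
      exact this.congr_deriv (mul_comm _ _)
    have hαn : ∀ s, ‖α s‖ ≤ C * Real.exp (-(L s).re) := fun s => by
      simp only [hα, Complex.norm_exp, Complex.neg_re]
      exact le_mul_of_one_le_left (Real.exp_pos _).le hC1
    have hβn : ∀ s, 0 ≤ s → s ≤ y → ‖β s‖ ≤ C * Real.exp (-(L s).re) := fun s hs hsy => by
      have h1 := hLsub s y hs hsy
      have h2 := hM s y hs hsy
      have h3 : ‖β s‖ = Real.exp ((L s).re - 2 * (L y).re) := by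
        simp [hβ, Complex.norm_exp]
      rw [h3]
      calc Real.exp ((L s).re - 2 * (L y).re) ≤ Real.exp (2 * M + -(L s).re) :=
            Real.exp_le_exp.2 (by linarith)
        _ = Real.exp (2 * M) * Real.exp (-(L s).re) := Real.exp_add _ _
        _ ≤ _ := mul_le_mul_of_nonneg_right hCe (Real.exp_pos _).le
    have hvd : ∀ s, 0 ≤ s → HasDerivWithinAt
        (fun t => (!₂[α t * u₁ t 0, β t * u₁ t 1] : EuclideanSpace ℂ (Fin 2)))
        !₂[α s * (Matrix.toEuclideanCLM (𝕜 := ℂ) (R s) (u₁ s)) 0,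
          β s * (Matrix.toEuclideanCLM (𝕜 := ℂ) (R s) (u₁ s)) 1] (Set.Ici 0) s := by
      intro s hs
      apply vec_deriv α β (a s) u₁ (R s) (Set.Ici 0) s (hαd s) (hβd s)
      rw [haeq s hs]
      exact hu s hs
    have hBc : Continuous (fun t => (C * k t) * φ t) := (continuous_const.mul hkc).mul hφc
    have := image_norm_le_of_norm_deriv_right_le_deriv_boundary (a := 0) (b := y)
      (f := fun t => (!₂[α t * u₁ t 0, β t * u₁ t 1] : EuclideanSpace ℂ (Fin 2)))
      (f' := fun s => !₂[α s * (Matrix.toEuclideanCLM (𝕜 := ℂ) (R s) (u₁ s)) 0,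
          β s * (Matrix.toEuclideanCLM (𝕜 := ℂ) (R s) (u₁ s)) 1])
      (B := fun s => C * ‖u₁ 0‖ + ∫ t in (0:ℝ)..s, (C * k t) * φ t)
      (B' := fun t => (C * k t) * φ t)
      (fun s hs => (hvd s hs.1).continuousWithinAt.mono Set.Icc_subset_Ici_self)
      (fun s hs => (hvd s hs.1).mono (Set.Ici_subset_Ici.2 hs.1))
      (by
        simp only [intervalIntegral.integral_same, add_zero]
        have e1 := hαn 0
        have e2 := hβn 0 le_rfl hy
        rw [hL0] at e1 e2
        simp only [Complex.zero_re, neg_zero, Real.exp_zero, mul_one] at e1 e2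
        exact diag_bound _ _ C hC0 e1 e2 _)
      (fun s => (hBc.integral_hasStrictDerivAt 0 s).hasDerivAt.const_add _)
      (by
        intro s hs
        refine (diag_bound _ _ (C * Real.exp (-(L s).re)) (by positivity) (hαn s)
          (hβn s hs.1 hs.2.le) _).trans ?_
        have e := (Matrix.toEuclideanCLM (𝕜 := ℂ) (R s)).le_opNorm (u₁ s)
        rw [← hkeq s hs.1] at e
        have e2 := mul_le_mul_of_nonneg_left e
          (show 0 ≤ C * Real.exp (-(L s).re) by positivity)
        refine e2.trans (le_of_eq ?_)
        simp only [hφ, max_eq_left hs.1]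
        ring)
      (Set.right_mem_Icc.2 hy)
    refine le_trans (le_of_eq ?_) this
    have hβy : β y = α y := by simp only [hα, hβ]; congr 1; ring
    have hv : (!₂[α y * u₁ y 0, β y * u₁ y 1] : EuclideanSpace ℂ (Fin 2)) = α y • u₁ y := by
      rw [hβy]
      ext i
      fin_cases i <;> simp
    simp only [hv, norm_smul, hφ, max_eq_left hy]
    simp [hα, Complex.norm_exp]
  have hg := gron (fun t => C * k t) φ (continuous_const.mul hkc) hφc
    (fun t => mul_nonneg hC0 (hk0 t)) (C * ‖u₁ 0‖) hint x hx
  have hkI : ∫ t in (0:ℝ)..x, C * k t ≤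
      C * ∫ t in Set.Ici (0:ℝ), ‖Matrix.toEuclideanCLM (𝕜 := ℂ) (R t)‖ := by
    rw [intervalIntegral.integral_const_mul]
    refine mul_le_mul_of_nonneg_left ?_ hC0
    have e : ∫ t in (0:ℝ)..x, k t =
        ∫ t in (0:ℝ)..x, ‖Matrix.toEuclideanCLM (𝕜 := ℂ) (R t)‖ := by
      apply intervalIntegral.integral_congr
      intro t ht
      rw [Set.uIcc_of_le hx] at ht
      exact hkeq t ht.1
    rw [e, intervalIntegral.integral_of_le hx]
    apply setIntegral_mono_set hRint
    · exact Filter.Eventually.of_forall fun t => norm_nonneg _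
    · exact (show Set.Ioc 0 x ⊆ Set.Ici (0:ℝ) from fun t ht => ht.1.le).eventuallyLE
  have hLx : (L x).re = ∫ t in (0:ℝ)..x, (lam t).re := by
    have := hLsub 0 x le_rfl hx
    rw [hL0] at this
    simpa using this
  rw [← hLx]
  have hux : ‖u₁ x‖ = Real.exp (L x).re * φ x := by
    simp only [hφ, max_eq_left hx]
    rw [← mul_assoc, ← Real.exp_add]
    simp
  rw [hux]
  calc Real.exp (L x).re * φ x
      ≤ Real.exp (L x).re * (C * ‖u₁ 0‖ * Real.exp (C * ∫ t in Set.Ici (0:ℝ),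
          ‖Matrix.toEuclideanCLM (𝕜 := ℂ) (R t)‖)) := by
        refine mul_le_mul_of_nonneg_left (hg.trans ?_) (Real.exp_pos _).le
        exact mul_le_mul_of_nonneg_left (Real.exp_le_exp.2 hkI) (by positivity)
    _ = _ := by ring
end

section
/- Let λ : [0,∞) → ℂ and R : [0,∞) → M₂(ℂ) be continuous with ∫_0^∞ ‖R(t)‖ dt < ∞, suppose there exists a constant M such that ∫_x^y Re λ(t) dt ≥ -M for all 0 ≤ x ≤ y, and suppose in addition that the improper integral ∫_0^∞ Re λ(t) dt converges to a finite value. Let u₁ : [0,∞) → ℂ² be a differentiable solution of u₁'(x) = (diag(λ(x), -λ(x)) + R(x)) u₁(x). Then the improper integral I := ∫_0^∞ diag(e^{-∫_0^t λ(s)ds}, e^{∫_0^t λ(s)ds}) R(t) u₁(t) dt converges, and diag(e^{-∫_0^x λ(s)ds}, e^{∫_0^x λ(s)ds}) u₁(x) → u₁(0) + I as x → ∞; equivalently, u₁(x) = diag(e^{∫_0^x λ(s)ds}, e^{-∫_0^x λ(s)ds}) [u₁(0) + I + o(1)] as x → ∞. -/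
open MeasureTheory Matrix Filter

lemma levinson_aux {V : Type*} [NormedAddCommGroup V] [NormedSpace ℝ V] [CompleteSpace V]
    (v v' : ℝ → V) (g : ℝ → ℝ) (hv : ∀ x ∈ Set.Ici (0:ℝ), HasDerivWithinAt v (v' x) (Set.Ici 0) x)
    (hv' : ContinuousOn v' (Set.Ici 0)) (hg : ContinuousOn g (Set.Ici 0)) (hg0 : ∀ x, 0 ≤ g x)
    (hgi : IntegrableOn g (Set.Ici 0)) (hb : ∀ x ∈ Set.Ici (0:ℝ), ‖v' x‖ ≤ g x * ‖v x‖) :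
    ∃ Iv : V, Tendsto (fun b : ℝ => ∫ t in (0:ℝ)..b, v' t) atTop (nhds Iv) ∧
      Tendsto v atTop (nhds (v 0 + Iv)) := by
  have hgc : Continuous (fun t => g (max t 0)) :=
    hg.comp_continuous (by fun_prop) (fun x => le_max_right x 0)
  have hvc : ContinuousOn v (Set.Ici 0) := fun x hx => (hv x hx).continuousWithinAt
  set G : ℝ → ℝ := fun x => ∫ t in (0:ℝ)..x, g (max t 0) with hG
  have hGd : ∀ x, HasDerivAt G (g (max x 0)) x := fun x =>
    intervalIntegral.integral_hasDerivAt_right (hgc.intervalIntegrable _ _)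
      (hgc.stronglyMeasurableAtFilter _ _) hgc.continuousAt
  set T : ℝ := ∫ t in Set.Ioi (0:ℝ), g t
  have hGT : ∀ x, 0 ≤ x → G x ≤ T := by
    intro x hx
    have : G x = ∫ t in (0:ℝ)..x, g t := by
      apply intervalIntegral.integral_congr
      intro t ht
      rw [Set.uIcc_of_le hx] at ht
      simp [ht.1]
    rw [this, intervalIntegral.integral_of_le hx]
    apply setIntegral_mono_set (hgi.mono_set Set.Ioi_subset_Ici_self)
      (Eventually.of_forall hg0)
    exact (Set.Ioc_subset_Ioi_self).eventuallyLE
  set K : ℝ := ‖v 0‖ + 1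
  have hK : 0 < K := by positivity
  have key : ∀ x, 0 ≤ x → ‖v x‖ ≤ K * Real.exp (G x + 1 - Real.exp (-x)) := by
    intro x hx
    refine image_norm_le_of_norm_deriv_right_lt_deriv_boundary (a := 0) (b := x) (f' := v')
      (B := fun x => K * Real.exp (G x + 1 - Real.exp (-x)))
      (B' := fun x => K * (Real.exp (G x + 1 - Real.exp (-x)) * (g (max x 0) + Real.exp (-x))))
      (hvc.mono Set.Icc_subset_Ici_self)
      (fun y hy => (hv y hy.1).mono (Set.Ici_subset_Ici.2 hy.1)) ?_ ?_ ?_ ⟨hx, le_rfl⟩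
    · simp [hG, K]
    · intro y
      have h1 : HasDerivAt (fun x : ℝ => Real.exp (-x)) (Real.exp (-y) * (-1)) y :=
        (hasDerivAt_neg y).exp
      have h2 := ((((hGd y).add_const 1).sub h1).exp).const_mul K
      refine h2.congr_deriv ?_
      simp only [Pi.sub_apply]
      ring
    · intro y hy he
      have h3 := hb y hy.1
      rw [he] at h3
      refine h3.trans_lt ?_
      rw [max_eq_left hy.1]
      have : 0 < K * Real.exp (G y + 1 - Real.exp (-y)) * Real.exp (-y) := by positivity
      linarith
  have key2 : ∀ x, 0 ≤ x → ‖v x‖ ≤ K * Real.exp (T + 1) := by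
    intro x hx
    refine (key x hx).trans ?_
    have := hGT x hx
    have := Real.exp_pos (-x)
    gcongr
    linarith
  have hint : IntegrableOn v' (Set.Ioi 0) := by
    have hgi' := (hgi.mono_set Set.Ioi_subset_Ici_self).mul_const (K * Real.exp (T + 1))
    refine Integrable.mono' hgi' ((hv'.mono Set.Ioi_subset_Ici_self).aestronglyMeasurable
      measurableSet_Ioi) ?_
    filter_upwards [ae_restrict_mem measurableSet_Ioi] with x hx
    have hx' : (0:ℝ) ≤ x := le_of_lt hx
    exact (hb x hx').trans (mul_le_mul_of_nonneg_left (key2 x hx') (hg0 x))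
  have ht := intervalIntegral_tendsto_integral_Ioi (0:ℝ) hint tendsto_id
  refine ⟨_, ht, ?_⟩
  refine (ht.const_add (v 0)).congr' ?_
  filter_upwards [eventually_ge_atTop (0:ℝ)] with x hx
  have := intervalIntegral.integral_eq_sub_of_hasDeriv_right_of_le hx
    (hvc.mono Set.Icc_subset_Ici_self)
    (fun y hy => (hv y hy.1.le).mono (Set.Ioi_subset_Ici hy.1.le))
    ((hv'.mono Set.Icc_subset_Ici_self).intervalIntegrable_of_Icc hx)
  simp only [id]
  rw [this]; abel

lemma levinson_diag (d : Fin 2 → ℂ) (C : ℝ) (hC : 0 ≤ C) (h : ∀ i, ‖d i‖ ≤ C)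
    (w : EuclideanSpace ℂ (Fin 2)) :
    ‖Matrix.toEuclideanCLM (𝕜 := ℂ) (Matrix.diagonal d) w‖ ≤ C * ‖w‖ := by
  refine (ContinuousLinearMap.le_opNorm _ _).trans ?_
  gcongr
  have := Matrix.l2_opNorm_diagonal d
  rw [Matrix.l2_opNorm_def] at this
  refine (le_of_eq this).trans ((pi_norm_le_iff_of_nonneg hC).2 h)

lemma levinson_cont : Continuous (fun A : Matrix (Fin 2) (Fin 2) ℂ =>
    Matrix.toEuclideanCLM (𝕜 := ℂ) A) :=
  LinearMap.continuous_of_finiteDimensional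
    ((Matrix.toEuclideanCLM (n := Fin 2) (𝕜 := ℂ)).toAlgEquiv.toLinearMap)

lemma levinson_apply (d : Fin 2 → ℂ) (w : EuclideanSpace ℂ (Fin 2)) (i : Fin 2) :
    (Matrix.toEuclideanCLM (𝕜 := ℂ) (Matrix.diagonal d) w) i = d i * w i := by
  rw [Matrix.ofLp_toEuclideanCLM, Matrix.mulVec_diagonal]



/-- Levinson-type asymptotics in the case `∫_0^∞ Re λ < ∞`:
`diag(e^{-∫_0^x λ}, e^{∫_0^x λ}) u₁(x) → u₁(0) + I` as `x → ∞`. -/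
theorem levinson_asymptotics_elliptic
    (lam : ℝ → ℂ) (R : ℝ → Matrix (Fin 2) (Fin 2) ℂ)
    (hlam : ContinuousOn lam (Set.Ici 0)) (hR : ContinuousOn R (Set.Ici 0))
    (hRint : IntegrableOn (fun t => ‖Matrix.toEuclideanCLM (𝕜 := ℂ) (R t)‖) (Set.Ici 0))
    (M : ℝ) (hM : ∀ x y : ℝ, 0 ≤ x → x ≤ y → -M ≤ ∫ t in x..y, (lam t).re)
    (L : ℝ) (hL : Tendsto (fun x : ℝ => ∫ t in (0:ℝ)..x, (lam t).re) atTop (nhds L))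
    (u₁ : ℝ → EuclideanSpace ℂ (Fin 2))
    (hu : ∀ x ∈ Set.Ici (0 : ℝ), HasDerivWithinAt u₁
      ((Matrix.toEuclideanCLM (𝕜 := ℂ) (Matrix.diagonal ![lam x, -lam x] + R x)) (u₁ x))
      (Set.Ici 0) x) :
    ∃ Iv : EuclideanSpace ℂ (Fin 2),
      Tendsto (fun b : ℝ => ∫ t in (0:ℝ)..b,
          (Matrix.toEuclideanCLM (𝕜 := ℂ)
              (Matrix.diagonal ![Complex.exp (-∫ s in (0:ℝ)..t, lam s),
                Complex.exp (∫ s in (0:ℝ)..t, lam s)]))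
            ((Matrix.toEuclideanCLM (𝕜 := ℂ) (R t)) (u₁ t)))
        atTop (nhds Iv) ∧
      Tendsto (fun x : ℝ =>
          (Matrix.toEuclideanCLM (𝕜 := ℂ)
              (Matrix.diagonal ![Complex.exp (-∫ s in (0:ℝ)..x, lam s),
                Complex.exp (∫ s in (0:ℝ)..x, lam s)]))
            (u₁ x))
        atTop (nhds (u₁ 0 + Iv)) := by


  set P : ℝ → ℂ := fun x => ∫ s in (0:ℝ)..x, lam s with hP
  have hlc : Continuous (fun t => lam (max t 0)) :=
    hlam.comp_continuous (by fun_prop) (fun x => le_max_right x 0)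
  have hPd : ∀ x ∈ Set.Ici (0:ℝ), HasDerivWithinAt P (lam x) (Set.Ici 0) x := by
    intro x hx
    have h1 : HasDerivAt (fun x => ∫ s in (0:ℝ)..x, lam (max s 0)) (lam (max x 0)) x :=
      intervalIntegral.integral_hasDerivAt_right (hlc.intervalIntegrable _ _)
        (hlc.stronglyMeasurableAtFilter _ _) hlc.continuousAt
    rw [max_eq_left hx] at h1
    have heq : ∀ y ∈ Set.Ici (0:ℝ), P y = ∫ s in (0:ℝ)..y, lam (max s 0) := by
      intro y hy
      apply intervalIntegral.integral_congr
      intro t ht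
      rw [Set.uIcc_of_le hy] at ht
      simp [ht.1]
    exact h1.hasDerivWithinAt.congr heq (heq x hx)
  have hii : ∀ x y : ℝ, 0 ≤ x → x ≤ y → IntervalIntegrable lam volume x y := fun x y hx hxy =>
    (hlam.mono (fun t ht => hx.trans ht.1)).intervalIntegrable_of_Icc hxy
  have hii' : ∀ x y : ℝ, 0 ≤ x → x ≤ y → IntervalIntegrable (fun t => (lam t).re) volume x y :=
    fun x y hx hxy => ((Complex.continuous_re.comp_continuousOn hlam).mono
      (fun t ht => hx.trans ht.1)).intervalIntegrable_of_Icc hxy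
  have hPre : ∀ x, 0 ≤ x → (P x).re = ∫ t in (0:ℝ)..x, (lam t).re := by
    intro x hx
    exact (Complex.reCLM.intervalIntegral_comp_comm (hii 0 x le_rfl hx)).symm
  have hlow : ∀ x, 0 ≤ x → -M ≤ (P x).re := fun x hx => by
    rw [hPre x hx]; exact hM 0 x le_rfl hx
  have hup : ∀ x, 0 ≤ x → (P x).re ≤ L + M := by
    intro x hx
    rw [hPre x hx]
    have : (∫ t in (0:ℝ)..x, (lam t).re) - M ≤ L := by
      refine ge_of_tendsto hL ?_
      filter_upwards [eventually_ge_atTop x] with y hy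
      have h1 := hM x y hx hy
      rw [← intervalIntegral.integral_add_adjacent_intervals (hii' 0 x le_rfl hx) (hii' x y hx hy)]
      linarith
    linarith
  set C : ℝ := Real.exp (|M| + |L|) with hCdef
  have hC : 0 ≤ C := (Real.exp_pos _).le
  have hM' := le_abs_self M
  have hM'' := neg_abs_le M
  have hL' := le_abs_self L
  have hL0 := abs_nonneg L
  have hb1 : ∀ x, 0 ≤ x → ‖Complex.exp (P x)‖ ≤ C := fun x hx => by
    rw [Complex.norm_exp]
    exact Real.exp_le_exp.2 (by linarith [hup x hx])
  have hb2 : ∀ x, 0 ≤ x → ‖Complex.exp (-P x)‖ ≤ C := fun x hx => by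
    rw [Complex.norm_exp, Complex.neg_re]
    exact Real.exp_le_exp.2 (by linarith [hlow x hx])
  have hRc : ContinuousOn (fun t => Matrix.toEuclideanCLM (𝕜 := ℂ) (R t)) (Set.Ici 0) :=
    levinson_cont.comp_continuousOn hR
  have hPc : ContinuousOn P (Set.Ici 0) := fun x hx => (hPd x hx).continuousWithinAt
  have huc : ContinuousOn u₁ (Set.Ici 0) := fun x hx => (hu x hx).continuousWithinAt
  have hEc : ContinuousOn (fun t => Matrix.toEuclideanCLM (𝕜 := ℂ)
      (Matrix.diagonal ![Complex.exp (-P t), Complex.exp (P t)])) (Set.Ici 0) := by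
    refine levinson_cont.comp_continuousOn ?_
    refine (Continuous.matrix_diagonal continuous_id).comp_continuousOn ?_
    refine continuousOn_pi.2 fun i => ?_
    fin_cases i
    · exact hPc.neg.cexp
    · exact hPc.cexp
  have hmain := levinson_aux
    (fun x : ℝ => (Matrix.toEuclideanCLM (𝕜 := ℂ)
              (Matrix.diagonal ![Complex.exp (-P x), Complex.exp (P x)])) (u₁ x))
    (fun t : ℝ => (Matrix.toEuclideanCLM (𝕜 := ℂ)
              (Matrix.diagonal ![Complex.exp (-P t), Complex.exp (P t)]))
            ((Matrix.toEuclideanCLM (𝕜 := ℂ) (R t)) (u₁ t)))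
    (fun t => C * C * ‖Matrix.toEuclideanCLM (𝕜 := ℂ) (R t)‖)
    ?_ (hEc.clm_apply (hRc.clm_apply huc)) (continuousOn_const.mul hRc.norm)
    (fun x => by positivity) (hRint.const_mul _) ?_
  · have hv0 : (Matrix.toEuclideanCLM (𝕜 := ℂ)
              (Matrix.diagonal ![Complex.exp (-P 0), Complex.exp (P 0)])) (u₁ 0) = u₁ 0 := by
      ext i
      fin_cases i <;> simp [hP, levinson_apply]
    simp only [hv0] at hmain
    exact hmain
  · intro x hx
    have hux : ∀ i, HasDerivWithinAt (fun y => u₁ y i) ((![lam x, -lam x] i) * u₁ x i +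
        (Matrix.toEuclideanCLM (𝕜 := ℂ) (R x) (u₁ x)) i) (Set.Ici 0) x := by
      intro i
      have h0 := (hasDerivWithinAt_pi.1 ((PiLp.continuousLinearEquiv 2 ℝ
        (fun _ : Fin 2 => ℂ)).hasFDerivAt.comp_hasDerivWithinAt x (hu x hx))) i
      rw [map_add, _root_.add_apply] at h0
      rw [← levinson_apply]
      exact h0
    suffices h : ∀ i, HasDerivWithinAt (fun y => (![Complex.exp (-P y), Complex.exp (P y)] i) * u₁ y i)
        ((![Complex.exp (-P x), Complex.exp (P x)] i) *
          (Matrix.toEuclideanCLM (𝕜 := ℂ) (R x) (u₁ x)) i) (Set.Ici 0) x by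
      have h0 := (PiLp.continuousLinearEquiv 2 ℝ
        (fun _ : Fin 2 => ℂ)).symm.hasFDerivAt.comp_hasDerivWithinAt x (hasDerivWithinAt_pi.2 h)
      convert h0 using 1
      · ext y i
        rw [levinson_apply]; rfl
      · ext i
        rw [levinson_apply]; rfl
    intro i
    fin_cases i
    · have h1 := (hPd x hx).neg.cexp.mul (hux 0)
      refine h1.congr_deriv ?_
      simp
      ring
    · have h1 := (hPd x hx).cexp.mul (hux 1)
      refine h1.congr_deriv ?_
      simp
      ring
  · intro x hx
    refine (levinson_diag _ C hC ?_ _).trans ?_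
    · intro i; fin_cases i
      · exact hb2 x hx
      · exact hb1 x hx
    · have h1 : u₁ x = Matrix.toEuclideanCLM (𝕜 := ℂ)
          (Matrix.diagonal ![Complex.exp (P x), Complex.exp (-P x)])
          (Matrix.toEuclideanCLM (𝕜 := ℂ)
              (Matrix.diagonal ![Complex.exp (-P x), Complex.exp (P x)]) (u₁ x)) := by
        ext i
        fin_cases i <;>
          simp [levinson_apply, ← mul_assoc, ← Complex.exp_add]
      have h2 : ‖u₁ x‖ ≤ C * ‖Matrix.toEuclideanCLM (𝕜 := ℂ)
              (Matrix.diagonal ![Complex.exp (-P x), Complex.exp (P x)]) (u₁ x)‖ := by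
        conv_lhs => rw [h1]
        refine levinson_diag _ C hC ?_ _
        intro i; fin_cases i
        · exact hb1 x hx
        · exact hb2 x hx
      calc _ ≤ C * (‖Matrix.toEuclideanCLM (𝕜 := ℂ) (R x)‖ * ‖u₁ x‖) := by
            gcongr; exact ContinuousLinearMap.le_opNorm _ _
        _ ≤ C * (‖Matrix.toEuclideanCLM (𝕜 := ℂ) (R x)‖ * (C * _)) := by gcongr
        _ = _ := by ring
end

section
/- Let λ : [0,∞) → ℂ and R : [0,∞) → M₂(ℂ) be continuous with ∫_0^∞ ‖R(t)‖ dt < ∞, suppose there exists a constant M such that ∫_x^y Re λ(t) dt ≥ -M for all 0 ≤ x ≤ y, and suppose in addition that ∫_0^x Re λ(t) dt → +∞ as x → ∞. Let u₁ : [0,∞) → ℂ² be a differentiable solution of u₁'(x) = (diag(λ(x), -λ(x)) + R(x)) u₁(x). Then the improper integral J := ∫_0^∞ e^{-∫_0^t λ(s)ds} R(t) u₁(t) dt converges, and e^{-∫_0^x λ(s)ds} u₁(x) → diag(1,0) · (u₁(0) + J) as x → ∞; equivalently, u₁(x) = e^{∫_0^x λ(s)ds} [diag(1,0)(u₁(0)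 + J) + o(1)] as x → ∞. -/
open MeasureTheory Matrix Filter

lemma gron_aux (n r : ℝ → ℝ) (hn : Continuous n) (hr : Continuous r) (hr0 : ∀ t, 0 ≤ r t)
    (hri : IntegrableOn r (Set.Ioi 0)) (A B : ℝ) (hA : 0 ≤ A) (hB : 0 ≤ B)
    (h : ∀ x, 0 ≤ x → n x ≤ A + B * ∫ t in (0:ℝ)..x, r t * n t) :
    ∃ K, 0 ≤ K ∧ ∀ x, 0 ≤ x → n x ≤ K := by
  refine ⟨A * Real.exp (B * ∫ t in Set.Ioi (0:ℝ), r t), by positivity, fun x hx => ?_⟩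
  have hφ : ∀ x, HasDerivAt (fun x => A + B * ∫ t in (0:ℝ)..x, r t * n t) (B * (r x * n x)) x :=
    fun x => (((hr.mul hn).integral_hasStrictDerivAt 0 x).hasDerivAt.const_mul B).const_add A
  have hρ : ∀ x, HasDerivAt (fun x => Real.exp (-(B * ∫ t in (0:ℝ)..x, r t)))
      (Real.exp (-(B * ∫ t in (0:ℝ)..x, r t)) * -(B * r x)) x :=
    fun x => ((hr.integral_hasStrictDerivAt 0 x).hasDerivAt.const_mul B).neg.exp
  have hψ := fun x => (hφ x).mul (hρ x)
  have hanti : AntitoneOn ((fun x => A + B * ∫ t in (0:ℝ)..x, r t * n t) *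
      (fun x => Real.exp (-(B * ∫ t in (0:ℝ)..x, r t)))) (Set.Ici 0) := by
    refine antitoneOn_of_deriv_nonpos (convex_Ici 0)
      (fun x _ => (hψ x).continuousAt.continuousWithinAt)
      (fun x _ => (hψ x).differentiableAt.differentiableWithinAt) ?_
    intro x hx
    rw [interior_Ici] at hx
    rw [(hψ x).deriv]
    have h1 := h x (le_of_lt hx)
    have h2 : 0 ≤ (B * r x) * Real.exp (-(B * ∫ t in (0:ℝ)..x, r t)) :=
      mul_nonneg (mul_nonneg hB (hr0 x)) (Real.exp_pos _).le
    nlinarith [mul_le_mul_of_nonneg_left h1 h2]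
  have h3 := hanti (Set.self_mem_Ici) (Set.mem_Ici.2 hx) hx
  simp only [Pi.mul_apply, intervalIntegral.integral_same, mul_zero, add_zero, neg_zero,
    Real.exp_zero, mul_one, inv_one, Real.exp_neg] at h3
  rw [← div_eq_mul_inv, div_le_iff₀ (Real.exp_pos _)] at h3
  refine (h x hx).trans (h3.trans ?_)
  gcongr
  rw [intervalIntegral.integral_of_le hx]
  exact setIntegral_mono_set hri (ae_of_all _ hr0) (Set.Ioc_subset_Ioi_self.eventuallyLE)

lemma norm_le_aux (v : EuclideanSpace ℂ (Fin 2)) : ‖v‖ ≤ ‖v 0‖ + ‖v 1‖ := by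
  rw [EuclideanSpace.norm_eq, Fin.sum_univ_two]
  refine Real.sqrt_le_iff.2 ⟨by positivity, ?_⟩
  nlinarith [mul_nonneg (norm_nonneg (v 0)) (norm_nonneg (v 1))]

lemma core_aux (l : ℝ → ℂ) (hl : Continuous l)
    (R : ℝ → (EuclideanSpace ℂ (Fin 2) →L[ℂ] EuclideanSpace ℂ (Fin 2))) (hR : Continuous R)
    (hRint : IntegrableOn (fun t => ‖R t‖) (Set.Ioi 0))
    (M : ℝ) (hM : ∀ x y : ℝ, 0 ≤ x → x ≤ y → -M ≤ ∫ t in x..y, (l t).re)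
    (hdiv : Tendsto (fun x : ℝ => ∫ t in (0:ℝ)..x, (l t).re) atTop atTop)
    (u : ℝ → EuclideanSpace ℂ (Fin 2)) (hu : Continuous u)
    (h0 : ∀ x, 0 < x → HasDerivAt (fun x => u x 0) (l x * u x 0 + (R x (u x)) 0) x)
    (h1 : ∀ x, 0 < x → HasDerivAt (fun x => u x 1) (-l x * u x 1 + (R x (u x)) 1) x) :
    ∃ J : EuclideanSpace ℂ (Fin 2),
      Tendsto (fun b : ℝ => ∫ t in (0:ℝ)..b,
          Complex.exp (-∫ s in (0:ℝ)..t, l s) • (R t (u t))) atTop (nhds J) ∧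
      Tendsto (fun x : ℝ => Complex.exp (-∫ s in (0:ℝ)..x, l s) * u x 0)
        atTop (nhds (u 0 0 + J 0)) ∧
      Tendsto (fun x : ℝ => Complex.exp (-∫ s in (0:ℝ)..x, l s) * u x 1)
        atTop (nhds 0) := by
  obtain ⟨L, hLdef⟩ : ∃ L : ℝ → ℂ, L = fun x => ∫ s in (0:ℝ)..x, l s := ⟨_, rfl⟩
  have hLx : ∀ x, (∫ s in (0:ℝ)..x, l s) = L x := fun x => by rw [hLdef]
  simp only [hLx]
  have hLd : ∀ x, HasDerivAt L (l x) x := fun x => by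
    rw [hLdef]; exact (hl.integral_hasStrictDerivAt 0 x).hasDerivAt
  have hLc : Continuous L := continuous_iff_continuousAt.2 fun x => (hLd x).continuousAt
  have hLre : ∀ x, (L x).re = ∫ t in (0:ℝ)..x, (l t).re := fun x => by
    rw [hLdef]
    exact (Complex.reCLM.intervalIntegral_comp_comm (hl.intervalIntegrable 0 x)).symm
  simp only [← hLre] at hdiv
  have hre : Continuous fun t => (l t).re := Complex.continuous_re.comp hl
  have hM' : ∀ t x, 0 ≤ t → t ≤ x → -M ≤ (L x).re - (L t).re := fun t x ht htx => by
    rw [hLre, hLre, intervalIntegral.integral_interval_sub_left (hre.intervalIntegrable _ _)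
      (hre.intervalIntegrable _ _)]
    exact hM t x ht htx
  have hL0 : L 0 = 0 := by simp [hLdef]
  obtain ⟨g, hg⟩ : ∃ g : ℝ → EuclideanSpace ℂ (Fin 2),
    g = fun t => Complex.exp (-L t) • (R t (u t)) := ⟨_, rfl⟩
  have hgx : ∀ t, Complex.exp (-L t) • (R t (u t)) = g t := fun t => by rw [hg]
  simp only [hgx]
  have hgc : Continuous g := by
    rw [hg]; exact (Complex.continuous_exp.comp hLc.neg).smul (hR.clm_apply hu)
  have hgi : ∀ i, Continuous fun t => g t i := fun i => by fun_prop
  have hui : ∀ i, Continuous fun t => u t i := fun i => by fun_prop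
  have hRi : ∀ i, Continuous fun t => (R t (u t)) i := fun i => by
    have := hR.clm_apply hu
    fun_prop
  -- representation formulas
  have e0 : ∀ x, 0 ≤ x → Complex.exp (-L x) * u x 0 = u 0 0 + ∫ t in (0:ℝ)..x, g t 0 := by
    intro x hx
    have := intervalIntegral.integral_eq_sub_of_hasDerivAt_of_le hx
      (f := fun x => Complex.exp (-L x) * u x 0) (f' := fun t => g t 0)
      (by have := hui 0; fun_prop) (fun y hy => by
        have := (hLd y).neg.cexp.mul (h0 y hy.1)
        refine this.congr_deriv ?_
        simp [hg]; ring) ((hgi 0).intervalIntegrable _ _)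
    rw [this]; simp [hL0]
  have e1 : ∀ x, 0 ≤ x → Complex.exp (-L x) * u x 1 = Complex.exp (-2 * L x) * u 0 1 +
      ∫ t in (0:ℝ)..x, Complex.exp (-2 * (L x - L t)) * g t 1 := by
    intro x hx
    have := intervalIntegral.integral_eq_sub_of_hasDerivAt_of_le hx
      (f := fun x => Complex.exp (L x) * u x 1) (f' := fun t => Complex.exp (L t) * (R t (u t)) 1)
      (by have := hui 1; fun_prop) (fun y hy => by
        have := (hLd y).cexp.mul (h1 y hy.1)
        refine this.congr_deriv ?_
        ring) (Continuous.intervalIntegrable (by have := hRi 1; fun_prop) _ _)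
    have e : (fun t => Complex.exp (-2 * (L x - L t)) * g t 1) =
        fun t => Complex.exp (-2 * L x) * (Complex.exp (L t) * (R t (u t)) 1) := by
      funext t
      simp only [hg, PiLp.smul_apply, smul_eq_mul, ← mul_assoc, ← Complex.exp_add]
      congr 2; ring
    rw [e, intervalIntegral.integral_const_mul, this, hL0]
    have e' : Complex.exp (-L x) = Complex.exp (-2 * L x) * Complex.exp (L x) := by
      rw [← Complex.exp_add]; congr 1; ring
    rw [e', Complex.exp_zero]; ring
  -- kernel bound
  have hk : ∀ t x, 0 ≤ t → t ≤ x → ‖Complex.exp (-2 * (L x - L t))‖ ≤ Real.exp (2 * M) := by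
    intro t x ht htx
    rw [Complex.norm_exp]
    have := hM' t x ht htx
    gcongr
    simp
    linarith
  obtain ⟨n, hn⟩ : ∃ n : ℝ → ℝ, n = fun x => ‖Complex.exp (-L x) * u x 0‖ +
    ‖Complex.exp (-L x) * u x 1‖ := ⟨_, rfl⟩
  have hnc : Continuous n := by
    rw [hn]; have := hui 0; have := hui 1; fun_prop
  have hgn : ∀ t, ‖g t‖ ≤ ‖R t‖ * n t := by
    intro t
    have : g t = R t (Complex.exp (-L t) • u t) := by rw [hg]; simp
    rw [this]
    refine ((R t).le_opNorm _).trans ?_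
    gcongr
    refine (norm_le_aux _).trans ?_
    simp [hn]
  have hgin : ∀ t i, ‖g t i‖ ≤ ‖g t‖ := fun t i => PiLp.norm_apply_le (g t) i
  have hRnc : Continuous fun t => ‖R t‖ := hR.norm
  obtain ⟨K, hK0, hK⟩ := gron_aux n (fun t => ‖R t‖) hnc hRnc (fun t => norm_nonneg _) hRint
    (‖u 0 0‖ + Real.exp (2 * M) * ‖u 0 1‖) (1 + Real.exp (2 * M)) (by positivity) (by positivity)
    (by
      intro x hx
      have b0 : ‖∫ t in (0:ℝ)..x, g t 0‖ ≤ ∫ t in (0:ℝ)..x, ‖R t‖ * n t :=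
        intervalIntegral.norm_integral_le_of_norm_le hx
          (ae_of_all _ fun t _ => (hgin t 0).trans (hgn t))
          ((hRnc.mul hnc).intervalIntegrable _ _)
      have b1 : ‖∫ t in (0:ℝ)..x, Complex.exp (-2 * (L x - L t)) * g t 1‖ ≤
          ∫ t in (0:ℝ)..x, Real.exp (2 * M) * (‖R t‖ * n t) :=
        intervalIntegral.norm_integral_le_of_norm_le hx
          (ae_of_all _ fun t ht => by
            rw [norm_mul]
            exact mul_le_mul (hk t x ht.1.le ht.2) ((hgin t 1).trans (hgn t)) (norm_nonneg _)
              (Real.exp_pos _).le)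
          ((continuous_const.mul (hRnc.mul hnc)).intervalIntegrable _ _)
      rw [intervalIntegral.integral_const_mul] at b1
      have b2 : ‖Complex.exp (-2 * L x) * u 0 1‖ ≤ Real.exp (2 * M) * ‖u 0 1‖ := by
        rw [norm_mul]
        have := hk 0 x le_rfl hx
        rw [hL0, sub_zero] at this
        gcongr
      have : n x = ‖Complex.exp (-L x) * u x 0‖ + ‖Complex.exp (-L x) * u x 1‖ := by rw [hn]
      rw [this, e0 x hx, e1 x hx]
      have c0 := norm_add_le (u 0 0) (∫ t in (0:ℝ)..x, g t 0)
      have c1 := norm_add_le (Complex.exp (-2 * L x) * u 0 1)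
        (∫ t in (0:ℝ)..x, Complex.exp (-2 * (L x - L t)) * g t 1)
      linarith)
  have hgint : IntegrableOn g (Set.Ioi 0) := by
    refine Integrable.mono' (hRint.mul_const K) hgc.aestronglyMeasurable ?_
    refine (ae_restrict_iff' measurableSet_Ioi).2 (ae_of_all _ fun t ht => ?_)
    exact (hgn t).trans (mul_le_mul_of_nonneg_left (hK t (le_of_lt ht)) (norm_nonneg _))
  have hJ := intervalIntegral_tendsto_integral_Ioi 0 hgint tendsto_id
  have hexp : ∀ c : ℂ, Tendsto (fun x => Complex.exp (-2 * (L x - c))) atTop (nhds 0) := by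
    intro c
    rw [tendsto_zero_iff_norm_tendsto_zero]
    simp only [Complex.norm_exp]
    refine Real.tendsto_exp_atBot.comp ?_
    have : (fun x => (-2 * (L x - c)).re) = fun x => (-2) * ((L x).re + -c.re) := by
      funext x; simp; ring
    rw [this]
    exact (tendsto_atTop_add_const_right _ _ hdiv).const_mul_atTop_of_neg (by norm_num)
  refine ⟨∫ t in Set.Ioi 0, g t, hJ, ?_, ?_⟩
  · have : Tendsto (fun x => u 0 0 + (∫ t in (0:ℝ)..x, g t) 0) atTop
        (nhds (u 0 0 + (∫ t in Set.Ioi 0, g t) 0)) := by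
      refine tendsto_const_nhds.add ?_
      exact ((EuclideanSpace.proj (𝕜 := ℂ) (0 : Fin 2)).continuous.tendsto _).comp hJ
    refine this.congr' ?_
    filter_upwards [eventually_ge_atTop 0] with x hx
    rw [e0 x hx]
    congr 1
    exact ((EuclideanSpace.proj (𝕜 := ℂ) (0 : Fin 2)).intervalIntegral_comp_comm
      (hgc.intervalIntegrable 0 x)).symm
  · have hd : Tendsto (fun x => ∫ t in Set.Ioi (0:ℝ),
        (Set.Iic x).indicator (fun t => Complex.exp (-2 * (L x - L t)) * g t 1) t) atTop
        (nhds (∫ t in Set.Ioi (0:ℝ), (0:ℂ))) := by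
      refine tendsto_integral_filter_of_dominated_convergence
        (fun t => Real.exp (2 * M) * ‖g t‖) ?_ ?_ (hgint.norm.const_mul _) ?_
      · refine Eventually.of_forall fun x => ?_
        refine AEStronglyMeasurable.indicator ?_ measurableSet_Iic
        refine Continuous.aestronglyMeasurable ?_
        have := hgi 1
        fun_prop
      · refine Eventually.of_forall fun x => ?_
        refine (ae_restrict_iff' measurableSet_Ioi).2 (ae_of_all _ fun t ht => ?_)
        by_cases htx : t ∈ Set.Iic x
        · rw [Set.indicator_of_mem htx, norm_mul]
          exact mul_le_mul (hk t x (le_of_lt ht) htx) (hgin t 1) (norm_nonneg _) (Real.exp_pos _).le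
        · rw [Set.indicator_of_notMem htx, norm_zero]; positivity
      · refine ae_of_all _ fun t => ?_
        have := (hexp (L t)).mul_const (g t 1)
        rw [zero_mul] at this
        refine this.congr' ?_
        filter_upwards [eventually_ge_atTop t] with x hx
        rw [Set.indicator_of_mem (Set.mem_Iic.2 hx)]
    have hs := ((hexp 0).mul_const (u 0 1)).add hd
    simp only [integral_zero, zero_mul, add_zero, sub_zero] at hs
    refine hs.congr' ?_
    filter_upwards [eventually_ge_atTop 0] with x hx
    rw [e1 x hx, setIntegral_indicator measurableSet_Iic, Set.Ioi_inter_Iic,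
      intervalIntegral.integral_of_le hx]

/-- Levinson-type asymptotics in the case `∫_0^∞ Re λ = +∞`:
`e^{-∫_0^x λ} u₁(x) → diag(1,0)(u₁(0) + J)` as `x → ∞`. -/
theorem levinson_asymptotics_hyperbolic
    (lam : ℝ → ℂ) (R : ℝ → Matrix (Fin 2) (Fin 2) ℂ)
    (hlam : ContinuousOn lam (Set.Ici 0)) (hR : ContinuousOn R (Set.Ici 0))
    (hRint : IntegrableOn (fun t => ‖Matrix.toEuclideanCLM (𝕜 := ℂ) (R t)‖) (Set.Ici 0))
    (M : ℝ) (hM : ∀ x y : ℝ, 0 ≤ x → x ≤ y → -M ≤ ∫ t in x..y, (lam t).re)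
    (hdiv : Tendsto (fun x : ℝ => ∫ t in (0:ℝ)..x, (lam t).re) atTop atTop)
    (u₁ : ℝ → EuclideanSpace ℂ (Fin 2))
    (hu : ∀ x ∈ Set.Ici (0 : ℝ), HasDerivWithinAt u₁
      ((Matrix.toEuclideanCLM (𝕜 := ℂ) (Matrix.diagonal ![lam x, -lam x] + R x)) (u₁ x))
      (Set.Ici 0) x) :
    ∃ J : EuclideanSpace ℂ (Fin 2),
      Tendsto (fun b : ℝ => ∫ t in (0:ℝ)..b,
          Complex.exp (-∫ s in (0:ℝ)..t, lam s) •
            ((Matrix.toEuclideanCLM (𝕜 := ℂ) (R t)) (u₁ t)))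
        atTop (nhds J) ∧
      Tendsto (fun x : ℝ => Complex.exp (-∫ s in (0:ℝ)..x, lam s) • u₁ x)
        atTop (nhds ((Matrix.toEuclideanCLM (𝕜 := ℂ)
          (Matrix.diagonal ![(1 : ℂ), 0])) (u₁ 0 + J))) := by
  have hm : Continuous fun x : ℝ => max x 0 := by fun_prop
  have hmm : ∀ x : ℝ, max x 0 ∈ Set.Ici (0:ℝ) := fun x => Set.mem_Ici.2 (le_max_right _ _)
  have hme : ∀ x : ℝ, 0 ≤ x → max x 0 = x := fun x hx => max_eq_left hx
  have hT : Continuous (Matrix.toEuclideanCLM (n := Fin 2) (𝕜 := ℂ)) :=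
    LinearMap.continuous_of_finiteDimensional
      ((Matrix.toEuclideanCLM (n := Fin 2) (𝕜 := ℂ)).toAlgEquiv.toLinearMap)
  have huc : ContinuousOn u₁ (Set.Ici 0) := fun x hx => (hu x hx).continuousWithinAt
  have hint : ∀ x y : ℝ, 0 ≤ x → x ≤ y →
      (∫ t in x..y, (lam (max t 0)).re) = ∫ t in x..y, (lam t).re := by
    intro x y hx hxy
    refine intervalIntegral.integral_congr fun t ht => ?_
    rw [Set.uIcc_of_le hxy] at ht
    simp only [hme t (hx.trans ht.1)]
  have hintc : ∀ y : ℝ, 0 ≤ y →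
      (∫ t in (0:ℝ)..y, lam (max t 0)) = ∫ t in (0:ℝ)..y, lam t := by
    intro y hxy
    refine intervalIntegral.integral_congr fun t ht => ?_
    rw [Set.uIcc_of_le hxy] at ht
    simp only [hme t ht.1]
  have hder : ∀ x : ℝ, 0 < x → HasDerivAt (fun x => u₁ (max x 0))
      ((Matrix.toEuclideanCLM (𝕜 := ℂ) (Matrix.diagonal ![lam x, -lam x] + R x)) (u₁ x)) x := by
    intro x hx
    refine ((hu x hx.le).hasDerivAt (Ici_mem_nhds hx)).congr_of_eventuallyEq ?_
    filter_upwards [Ici_mem_nhds hx] with y hy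
    rw [hme y hy]
  have hcoord : ∀ x : ℝ, 0 < x → ∀ i : Fin 2, HasDerivAt (fun x => u₁ (max x 0) i)
      (((Matrix.toEuclideanCLM (𝕜 := ℂ) (Matrix.diagonal ![lam x, -lam x] + R x)) (u₁ x)) i) x :=
    fun x hx i =>
      ((EuclideanSpace.proj (𝕜 := ℂ) i).restrictScalars ℝ).hasFDerivAt.comp_hasDerivAt x (hder x hx)
  have hdiag : ∀ (a b : ℂ) (v : EuclideanSpace ℂ (Fin 2)),
      (Matrix.toEuclideanCLM (𝕜 := ℂ) (Matrix.diagonal ![a, b])) v 0 = a * v 0 ∧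
      (Matrix.toEuclideanCLM (𝕜 := ℂ) (Matrix.diagonal ![a, b])) v 1 = b * v 1 := by
    intro a b v
    constructor <;> simp [Matrix.ofLp_toEuclideanCLM, Matrix.mulVec_diagonal]
  obtain ⟨J, hJ, hv0, hv1⟩ := core_aux (fun x => lam (max x 0))
    (hlam.comp_continuous hm hmm) (fun x => Matrix.toEuclideanCLM (𝕜 := ℂ) (R (max x 0)))
    (hT.comp (hR.comp_continuous hm hmm))
    ((hRint.mono_set Set.Ioi_subset_Ici_self).congr_fun (fun t ht => by
      simp only [hme t (le_of_lt ht)]) measurableSet_Ioi)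
    M (fun x y hx hxy => by rw [hint x y hx hxy]; exact hM x y hx hxy)
    (hdiv.congr' (by
      filter_upwards [eventually_ge_atTop 0] with x hx
      rw [hint 0 x le_rfl hx]))
    (fun x => u₁ (max x 0)) (huc.comp_continuous hm hmm)
    (fun x hx => by
      have := hcoord x hx 0
      rw [map_add] at this
      simp only [hme x hx.le]
      rw [← (hdiag (lam x) (-lam x) (u₁ x)).1]
      exact this)
    (fun x hx => by
      have := hcoord x hx 1
      rw [map_add] at this
      simp only [hme x hx.le]
      rw [← (hdiag (lam x) (-lam x) (u₁ x)).2]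
      exact this)
  refine ⟨J, hJ.congr' ?_, ?_⟩
  · filter_upwards [eventually_ge_atTop 0] with b hb
    refine intervalIntegral.integral_congr fun t ht => ?_
    rw [Set.uIcc_of_le hb] at ht
    simp only [hintc t ht.1, hme t ht.1]
  · rw [(PiLp.homeomorph 2 (fun _ : Fin 2 => ℂ)).isInducing.tendsto_nhds_iff, tendsto_pi_nhds]
    intro i
    fin_cases i
    · have := hdiag 1 0 (u₁ 0 + J)
      refine Tendsto.congr' (f₁ := fun x => Complex.exp (-∫ s in (0:ℝ)..x, lam (max s 0)) *
        u₁ (max x 0) 0) ?_ ?_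
      · filter_upwards [eventually_ge_atTop 0] with x hx
        rw [hintc x hx, hme x hx]; rfl
      · convert hv0 using 2
        refine this.1.trans ?_
        simp
    · have := hdiag 1 0 (u₁ 0 + J)
      refine Tendsto.congr' (f₁ := fun x => Complex.exp (-∫ s in (0:ℝ)..x, lam (max s 0)) *
        u₁ (max x 0) 1) ?_ ?_
      · filter_upwards [eventually_ge_atTop 0] with x hx
        rw [hintc x hx, hme x hx]; rfl
      · convert hv1 using 2
        refine this.2.trans ?_
        simp
end
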